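/- arXiv:1310.1603 — 2 statements merged into one kernel-verified Lean document; each statement's English description precedes it below -/
import Mathlib

section
/- Let N be an integral g-lattice and M a g-maximal g-lattice in a nondegenerate ternary quadratic space (W,ψ) over an algebraic number field F (or a nonarchimedean local field). Then [A⁺(M)~/A⁺(M)] = (2⁻¹[M̃/M])² is independent of the choice of M, and [A⁺(N)~/A⁺(N)] = [A⁺(M)/A⁺(N)]²·[A⁺(M)~/A⁺(M)]. -/
noncomputable section

namespace Paper

variable (R F : Type*) [CommRing R] [Field F] [Algebra R F]

section Lattices

variable (W : Type*) [AddCommGroup W] [Module F W] [Module R W] [IsScalarTower R F W]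

/-- A `g`-lattice in `W`: a finitely generated `R`-submodule containing an `F`-basis. -/
def IsLat (L : Submodule R W) : Prop :=
  L.FG ∧ Submodule.span F (L : Set W) = ⊤

/-- integral lattice with respect to a bilinear form -/
def IsIntegralLat (ψ : LinearMap.BilinForm F W) (L : Submodule R W) : Prop :=
  IsLat R F W L ∧ ∀ x ∈ L, ψ x x ∈ (algebraMap R F).range

/-- maximal lattice with respect to a bilinear form -/
def IsMaximalLat (ψ : LinearMap.BilinForm F W) (L : Submodule R W) : Prop :=
  IsIntegralLat R F W ψ L ∧ ∀ L' : Submodule R W, IsIntegralLat R F W ψ L' → L ≤ L' → L' = L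

/-- the ideal `[L/M]` generated by determinants of `F`-automorphisms carrying `L` into `M` -/
def latIdx (L M : Submodule R W) : Submodule R F :=
  Submodule.span R {d : F | ∃ α : W ≃ₗ[F] W, (∀ x ∈ L, α x ∈ M) ∧
    LinearMap.det (α : W →ₗ[F] W) = d}

/-- the dual lattice `L~ = {x | 2ψ(x,L) ⊆ g}` -/
def dualLat (ψ : LinearMap.BilinForm F W) (L : Submodule R W) : Submodule R W :=
  ⨅ y ∈ L, Submodule.comap (((2 : F) • (ψ.flip y)).restrictScalars R)
    (LinearMap.range (Algebra.linearMap R F))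

/-- the ideal `[L/M]` for lattices spanning the subspace `U`, computed inside `U` -/
def latIdxIn (U : Submodule F W) (L M : Submodule R W) : Submodule R F :=
  latIdx R F ↥U (Submodule.comap ((U.subtype).restrictScalars R) L)
    (Submodule.comap ((U.subtype).restrictScalars R) M)

/-- product of a fractional ideal and a lattice -/
def idSMul {M : Type*} [AddCommGroup M] [Module F M] [Module R M] [IsScalarTower R F M]
    (I : Submodule R F) (N : Submodule R M) : Submodule R M :=
  Submodule.span R {z : M | ∃ c ∈ I, ∃ x ∈ N, z = c • x}

end Lattices

/-- the fractional ideal attached to an integral ideal -/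
def idealToF (I : Ideal R) : Submodule R F :=
  Submodule.map (Algebra.linearMap R F) I

section Clifford

variable (W : Type*) [AddCommGroup W] [Module F W] [Module R W] [IsScalarTower R F W]
variable (Q : QuadraticForm F W)

/-- the order `A(N)` generated by `g` and `N` in the Clifford algebra -/
def cliffordOrder (N : Submodule R W) : Subalgebra R (CliffordAlgebra Q) :=
  Algebra.adjoin R (CliffordAlgebra.ι Q '' (N : Set W))

/-- the even Clifford algebra, as an `R`-subalgebra -/
def evenR : Subalgebra R (CliffordAlgebra Q) :=
  (CliffordAlgebra.even Q).restrictScalars R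

/-- `A⁺(N) = A⁺(W) ∩ A(N)` -/
def APlus (N : Submodule R W) : Subalgebra R (CliffordAlgebra Q) :=
  evenR R F W Q ⊓ cliffordOrder R F W Q N

def APlusSub (N : Submodule R W) : Submodule R (CliffordAlgebra Q) :=
  Subalgebra.toSubmodule (APlus R F W Q N)

def oneLat : Submodule R (CliffordAlgebra Q) :=
  LinearMap.range (Algebra.linearMap R (CliffordAlgebra Q))

/-- the `R`-linear map `x ↦ 2ν(x,y) = x·y* + y·x*`, where `*` is the canonical
involution (reversal) of the Clifford algebra -/
def traceMap (y : CliffordAlgebra Q) : CliffordAlgebra Q →ₗ[R] CliffordAlgebra Q :=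
  ((LinearMap.mulRight F (CliffordAlgebra.reverse (Q := Q) y)) +
    (LinearMap.mulLeft F y) ∘ₗ (CliffordAlgebra.reverse (Q := Q))).restrictScalars R

/-- the dual `o~ = {x ∈ A⁺(W) | 2ν(x,o) ⊆ g}` with respect to the norm form
`ν[x] = x x*` of the even Clifford algebra -/
def normDual (o : Submodule R (CliffordAlgebra Q)) : Submodule R (CliffordAlgebra Q) :=
  Subalgebra.toSubmodule (evenR R F W Q) ⊓
    ⨅ y ∈ o, Submodule.comap (traceMap R F W Q y) (oneLat R F W Q)

/-- `A⁺(W)° = {x ∈ A⁺(W) | x* = -x}`, as an `R`-submodule -/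
def minusPart : Submodule R (CliffordAlgebra Q) :=
  Subalgebra.toSubmodule (evenR R F W Q) ⊓
    LinearMap.ker ((CliffordAlgebra.reverse (Q := Q) + LinearMap.id).restrictScalars R)

end Clifford

end Paper

namespace Paper

section Orders

variable (R F : Type*) [CommRing R] [Field F] [Algebra R F]
variable (A : Type*) [Ring A] [Algebra F A] [Algebra R A] [IsScalarTower R F A]

/-- an order in the `F`-subalgebra `B` of `A`: an `R`-subalgebra which is an `R`-lattice
in `B` -/
def IsOrderIn (B : Subalgebra F A) (o : Subalgebra R A) : Prop :=
  (Subalgebra.toSubmodule o).FG ∧ (o : Set A) ⊆ (B : Set A) ∧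
    Submodule.span F (o : Set A) = Subalgebra.toSubmodule B

/-- a maximal order in `B` -/
def IsMaximalOrderIn (B : Subalgebra F A) (o : Subalgebra R A) : Prop :=
  IsOrderIn R F A B o ∧ ∀ o' : Subalgebra R A, IsOrderIn R F A B o' → o ≤ o' → o' = o

end Orders

section Abbrev

variable (R F : Type*) [CommRing R] [Field F] [Algebra R F]
variable (W : Type*) [AddCommGroup W] [Module F W] [Module R W] [IsScalarTower R F W]
variable (psi : LinearMap.BilinForm F W)

/-- the ideal `[A⁺(M)/A⁺(N)]`, computed inside the quaternion algebra `A⁺(W)` -/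
def APlusIdx (M N : Submodule R W) : Submodule R F :=
  latIdxIn R F (CliffordAlgebra (LinearMap.BilinMap.toQuadraticMap psi))
    (Subalgebra.toSubmodule
      (CliffordAlgebra.even (LinearMap.BilinMap.toQuadraticMap psi)))
    (APlusSub R F W (LinearMap.BilinMap.toQuadraticMap psi) M)
    (APlusSub R F W (LinearMap.BilinMap.toQuadraticMap psi) N)

/-- the ideal `[A⁺(N)~/A⁺(N)]`, computed inside the quaternion algebra `A⁺(W)` -/
def APlusDualIdx (N : Submodule R W) : Submodule R F :=
  latIdxIn R F (CliffordAlgebra (LinearMap.BilinMap.toQuadraticMap psi))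
    (Subalgebra.toSubmodule
      (CliffordAlgebra.even (LinearMap.BilinMap.toQuadraticMap psi)))
    (normDual R F W (LinearMap.BilinMap.toQuadraticMap psi)
      (APlusSub R F W (LinearMap.BilinMap.toQuadraticMap psi) N))
    (APlusSub R F W (LinearMap.BilinMap.toQuadraticMap psi) N)

/-- the fractional ideal `2⁻¹·[Ñ/N]` -/
def halfDualIdx (N : Submodule R W) : Submodule R F :=
  Submodule.span R {((2 : F)⁻¹)} * latIdx R F W (dualLat R F W psi N) N

end Abbrev

end Paper

open Paper NumberField

set_option linter.unusedSectionVars false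

namespace Paper

section Localization

variable {R F V : Type*} [CommRing R] [Field F] [Algebra R F]
  [AddCommGroup V] [Module F V] [Module R V] [IsScalarTower R F V]

/-- The saturation `L_p ⊆ V` of a submodule `L` at a prime `p`: all `x` with `s • x ∈ L` for
some `s ∉ p`. -/
def locAt (p : Ideal R) [p.IsPrime] (L : Submodule R V) : Submodule R V where
  carrier := {x | ∃ s, s ∉ p ∧ s • x ∈ L}
  zero_mem' := ⟨1, (Ideal.ne_top_iff_one p).1 (Ideal.IsPrime.ne_top ‹_›), by simp⟩
  add_mem' := by
    rintro x y ⟨s, hs, hx⟩ ⟨t, ht, hy⟩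
    refine ⟨s * t, p.primeCompl.mul_mem hs ht, ?_⟩
    rw [smul_add]
    refine add_mem ?_ ?_
    · rw [mul_comm, mul_smul]; exact L.smul_mem _ hx
    · rw [mul_smul]; exact L.smul_mem _ hy
  smul_mem' := by
    rintro a x ⟨s, hs, hx⟩
    exact ⟨s, hs, by rw [smul_comm]; exact L.smul_mem _ hx⟩

variable {p : Ideal R} [p.IsPrime] {L M : Submodule R V}

theorem le_locAt : L ≤ locAt p L := fun x hx =>
  ⟨1, (Ideal.ne_top_iff_one p).1 (Ideal.IsPrime.ne_top ‹_›), by simpa using hx⟩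

theorem locAt_le_iff : locAt p L ≤ locAt p M ↔ L ≤ locAt p M := by
  refine ⟨fun h => le_locAt.trans h, fun h => ?_⟩
  rintro x ⟨s, hs, hx⟩
  obtain ⟨t, ht, hy⟩ := h hx
  exact ⟨t * s, p.primeCompl.mul_mem ht hs, by rwa [mul_smul]⟩

theorem locAt_mono (h : L ≤ M) : locAt p L ≤ locAt p M := locAt_le_iff.2 (h.trans le_locAt)

theorem mem_locAt_of_smul_mem {x : V} {s : R} (hs : s ∉ p) (h : s • x ∈ locAt p L) :
    x ∈ locAt p L := by
  obtain ⟨t, ht, hy⟩ := h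
  exact ⟨t * s, p.primeCompl.mul_mem ht hs, by rwa [mul_smul]⟩

theorem locAt_inf : locAt p (L ⊓ M) = locAt p L ⊓ locAt p M := by
  refine le_antisymm (le_inf (locAt_mono inf_le_left) (locAt_mono inf_le_right)) ?_
  rintro x ⟨⟨s, hs, hx⟩, ⟨t, ht, hy⟩⟩
  refine ⟨s * t, p.primeCompl.mul_mem hs ht, ?_, ?_⟩
  · rw [mul_comm, mul_smul]; exact L.smul_mem _ hx
  · rw [mul_smul]; exact M.smul_mem _ hy

theorem exists_smul_mem_of_fg (hL : L.FG) (h : L ≤ locAt p M) :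
    ∃ s, s ∉ p ∧ ∀ x ∈ L, s • x ∈ M := by
  obtain ⟨S, rfl⟩ := hL
  have key : ∃ s, s ∉ p ∧ ∀ x ∈ S, s • x ∈ M := by
    classical
    replace h : ∀ x ∈ S, x ∈ locAt p M := fun x hx => h (Submodule.subset_span hx)
    induction S using Finset.induction_on with
    | empty => exact ⟨1, (Ideal.ne_top_iff_one p).1 (Ideal.IsPrime.ne_top ‹_›), by simp⟩
    | insert a S _ ih =>
      obtain ⟨s, hs, H⟩ := ih fun x hx => h x (Finset.mem_insert_of_mem hx)
      obtain ⟨t, ht, hta⟩ := h a (Finset.mem_insert_self _ _)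
      refine ⟨s * t, p.primeCompl.mul_mem hs ht, fun x hx => ?_⟩
      rcases Finset.mem_insert.1 hx with rfl | hx
      · rw [mul_smul]; exact M.smul_mem _ hta
      · rw [mul_comm, mul_smul]; exact M.smul_mem _ (H x hx)
  obtain ⟨s, hs, H⟩ := key
  refine ⟨s, hs, fun x hx => ?_⟩
  have : Submodule.span R (S : Set V) ≤ M.comap (LinearMap.lsmul R V s) :=
    Submodule.span_le.2 fun x hx => H x hx
  exact this hx

theorem le_of_locAt_le (hR : ¬ IsField R)
    (h : ∀ (p : Ideal R) [p.IsMaximal], p ≠ ⊥ → L ≤ locAt p M) : L ≤ M := by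
  intro x hx
  rcases subsingleton_or_nontrivial R with hR' | hR'
  · have := Module.subsingleton R V
    rw [Subsingleton.elim x 0]; exact zero_mem _
  by_contra hxM
  let I : Ideal R := M.comap (LinearMap.toSpanSingleton R V x)
  have hI : I ≠ ⊤ := fun h1 => hxM (by
    have : (1 : R) ∈ I := h1 ▸ Submodule.mem_top
    simpa [I] using this)
  obtain ⟨m, hm, hIm⟩ := Ideal.exists_le_maximal I hI
  have hm0 : m ≠ ⊥ := Ring.ne_bot_of_isMaximal_of_not_isField hm hR
  obtain ⟨s, hs, hsx⟩ := h m hm0 hx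
  exact hs (hIm (by simpa [I] using hsx))

theorem eq_of_locAt_eq (hR : ¬ IsField R)
    (h : ∀ (p : Ideal R) [p.IsMaximal], p ≠ ⊥ → locAt p L = locAt p M) : L = M :=
  le_antisymm (le_of_locAt_le hR fun p _ hp => le_locAt.trans (h p hp).le)
    (le_of_locAt_le hR fun p _ hp => le_locAt.trans (h p hp).ge)

theorem locAt_mul_congr {I J I' J' : Submodule R F} (hI : locAt p I = locAt p I')
    (hJ : locAt p J = locAt p J') : locAt p (I * J) = locAt p (I' * J') := by
  have key : ∀ {I J I' J' : Submodule R F}, I ≤ locAt p I' → J ≤ locAt p J' →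
      I * J ≤ locAt p (I' * J') := by
    intro I J I' J' hI hJ
    rw [Submodule.mul_le]
    intro x hx y hy
    obtain ⟨s, hs, hsx⟩ := hI hx
    obtain ⟨t, ht, hty⟩ := hJ hy
    refine ⟨s * t, p.primeCompl.mul_mem hs ht, ?_⟩
    rw [← smul_mul_smul_comm]
    exact Submodule.mul_mem_mul hsx hty
  exact le_antisymm (locAt_le_iff.2 (key (le_locAt.trans hI.le) (le_locAt.trans hJ.le)))
    (locAt_le_iff.2 (key (le_locAt.trans hI.ge) (le_locAt.trans hJ.ge)))

end Localization

section LocalRing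

variable {R F V : Type*} [CommRing R] [IsDomain R] [Field F] [Algebra R F] [IsFractionRing R F]
  [AddCommGroup V] [Module F V] [Module R V] [IsScalarTower R F V]
  {ι : Type*} [Fintype ι]

variable (F) in
/-- The local ring of `R` at `p`, as a subring of the fraction field. -/
def intAt (p : Ideal R) [p.IsPrime] : Subalgebra R F :=
  Localization.subalgebra.ofField F p.primeCompl p.primeCompl_le_nonZeroDivisors

variable {p : Ideal R} [p.IsPrime] {L M : Submodule R V}

theorem algebraMap_ne_zero_of_notMem {s : R} (hs : s ∉ p) : algebraMap R F s ≠ 0 := by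
  intro h
  rw [map_eq_zero_iff _ (IsFractionRing.injective R F)] at h
  exact hs (h ▸ p.zero_mem)

theorem mem_intAt {x : F} :
    x ∈ intAt F p ↔ ∃ s, s ∉ p ∧ s • x ∈ (algebraMap R F).range := by
  constructor
  · rintro ⟨a, s, hs, rfl⟩
    refine ⟨s, hs, a, ?_⟩
    rw [Algebra.smul_def]
    field_simp [algebraMap_ne_zero_of_notMem (F := F) hs]
  · rintro ⟨s, hs, a, ha⟩
    refine ⟨a, s, hs, ?_⟩
    rw [ha, Algebra.smul_def]
    field_simp [algebraMap_ne_zero_of_notMem (F := F) hs]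

theorem inv_mem_intAt {s : R} (hs : s ∉ p) : (algebraMap R F s)⁻¹ ∈ intAt F p :=
  ⟨1, s, hs, by simp⟩

theorem smul_mem_locAt {c : F} (hc : c ∈ intAt F p) {x : V} (hx : x ∈ locAt p L) :
    c • x ∈ locAt p L := by
  obtain ⟨s, hs, a, ha⟩ := mem_intAt.1 hc
  refine mem_locAt_of_smul_mem hs ?_
  rw [← smul_assoc, ← ha, algebraMap_smul]
  exact Submodule.smul_mem _ _ hx

theorem mem_locAt_span_iff (b : Module.Basis ι F V) {x : V} :
    x ∈ locAt p (Submodule.span R (Set.range b)) ↔ ∀ i, b.repr x i ∈ intAt F p := by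
  constructor
  · rintro ⟨s, hs, hx⟩ i
    refine mem_intAt.2 ⟨s, hs, ?_⟩
    obtain ⟨f, hf⟩ := (Submodule.mem_span_range_iff_exists_fun _).1 hx
    have h1 : s • b.repr x i = b.repr (s • x) i := by
      rw [← algebraMap_smul F s x, map_smul, Finsupp.smul_apply, algebraMap_smul]
    have h2 : ∑ j, f j • b j = ∑ j, algebraMap R F (f j) • b j := by
      simp only [algebraMap_smul]
    rw [h1, ← hf, h2, Module.Basis.repr_sum_self]
    exact ⟨_, rfl⟩
  · intro h
    rw [← b.sum_repr x]
    exact sum_mem fun i _ =>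
      smul_mem_locAt (h i) (le_locAt (Submodule.subset_span (Set.mem_range_self i)))

theorem mem_locAt_span_singleton {d x : F} :
    x ∈ locAt p (Submodule.span R {d}) ↔ ∃ a ∈ intAt F p, x = a * d := by
  constructor
  · rintro ⟨s, hs, hx⟩
    obtain ⟨a, ha⟩ := Submodule.mem_span_singleton.1 hx
    refine ⟨(algebraMap R F s)⁻¹ * algebraMap R F a,
      mul_mem (inv_mem_intAt hs) (Subalgebra.algebraMap_mem _ _), ?_⟩
    rw [mul_assoc, ← Algebra.smul_def a d, ha, Algebra.smul_def]
    field_simp [algebraMap_ne_zero_of_notMem (F := F) hs]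
  · rintro ⟨a, ha, rfl⟩
    exact smul_mem_locAt (V := F) ha (le_locAt (Submodule.mem_span_singleton_self d))

theorem det_mem_intAt [DecidableEq ι] {A : Matrix ι ι F} (h : ∀ i j, A i j ∈ intAt F p) :
    A.det ∈ intAt F p := by
  rw [Matrix.det_apply]
  exact sum_mem fun σ _ => by
    rw [Units.smul_def]
    exact zsmul_mem (prod_mem fun i _ => h _ _) _

/-- `b` is a basis of the localization of `L` at `p`. -/
def IsLocBasis (p : Ideal R) [p.IsPrime] (b : Module.Basis ι F V) (L : Submodule R V) : Prop :=
  locAt p L = locAt p (Submodule.span R (Set.range b))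

variable {b c : Module.Basis ι F V}

theorem IsLocBasis.mem_iff (hb : IsLocBasis p b L) {x : V} :
    x ∈ locAt p L ↔ ∀ i, b.repr x i ∈ intAt F p := by
  rw [hb, mem_locAt_span_iff]

theorem IsLocBasis.self_mem (hb : IsLocBasis p b L) (i : ι) : b i ∈ locAt p L := by
  rw [hb]; exact le_locAt (Submodule.subset_span (Set.mem_range_self i))

theorem isLocBasis_iff : IsLocBasis p b L ↔ ∀ x, x ∈ locAt p L ↔ ∀ i, b.repr x i ∈ intAt F p := by
  refine ⟨fun h x => h.mem_iff, fun h => ?_⟩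
  ext x
  rw [h, mem_locAt_span_iff]

theorem IsLocBasis.of_le (h1 : ∀ i, b i ∈ locAt p L)
    (h2 : L ≤ locAt p (Submodule.span R (Set.range b))) : IsLocBasis p b L := by
  refine le_antisymm (locAt_le_iff.2 h2) (locAt_le_iff.2 (Submodule.span_le.2 ?_))
  rintro _ ⟨i, rfl⟩
  exact h1 i

theorem IsLocBasis.exists_smul_basis_mem (hb : IsLocBasis p b L) :
    ∃ s, s ∉ p ∧ ∀ i, s • b i ∈ L := by
  obtain ⟨s, hs, h⟩ := exists_smul_mem_of_fg (p := p) (M := L)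
    (Submodule.fg_span (Set.finite_range b)) (le_locAt.trans hb.ge)
  exact ⟨s, hs, fun i => h _ (Submodule.subset_span (Set.mem_range_self i))⟩

/-- Locally, `[L/M]` is generated by the determinant of a change of bases. -/
theorem locAt_latIdx [DecidableEq ι] (hL : L.FG) (hb : IsLocBasis p b L)
    (hc : IsLocBasis p c M) :
    locAt p (latIdx R F V L M) = locAt p (Submodule.span R {b.det c}) := by
  refine le_antisymm (locAt_le_iff.2 ?_) (locAt_le_iff.2 ?_)
  · refine Submodule.span_le.2 ?_
    rintro _ ⟨α, hα, rfl⟩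
    refine mem_locAt_span_singleton.2 ⟨c.det (α ∘ b), ?_, ?_⟩
    · rw [Module.Basis.det_apply]
      refine det_mem_intAt fun i j => ?_
      rw [Module.Basis.toMatrix_apply]
      refine (hc.mem_iff.1 ?_) i
      obtain ⟨s, hs, h⟩ := hb.self_mem j
      refine ⟨s, hs, ?_⟩
      have := hα _ h
      rwa [← algebraMap_smul F s (b j), map_smul, algebraMap_smul] at this
    · have h1 := Module.Basis.det_comp b (α : V →ₗ[F] V) b
      rw [Module.Basis.det_self, mul_one] at h1
      rw [← h1]
      have h2 := congrArg (fun f => f (α ∘ b)) (AlternatingMap.eq_smul_basis_det c b.det)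
      simp only [AlternatingMap.smul_apply, smul_eq_mul] at h2
      rw [mul_comm, ← h2]
      rfl
  · refine (Submodule.span_singleton_le_iff_mem _ _).2 ?_
    let α : V ≃ₗ[F] V := b.equiv c (Equiv.refl ι)
    have hαL : L.map ((α : V →ₗ[F] V).restrictScalars R) ≤ locAt p M := by
      rintro _ ⟨x, hx, rfl⟩
      rw [hc.mem_iff]
      intro i
      have h := hb.mem_iff.1 (le_locAt hx) i
      have : c.repr (α x) = b.repr x := by
        simp [α, Module.Basis.equiv]
      simpa [this] using h
    obtain ⟨s, hs, h⟩ := exists_smul_mem_of_fg (hL.map _) hαL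
    have hs0 := algebraMap_ne_zero_of_notMem (F := F) hs
    let β : V ≃ₗ[F] V := α.trans (LinearEquiv.smulOfNeZero F V _ hs0)
    refine ⟨s ^ Fintype.card ι, p.primeCompl.pow_mem hs _, Submodule.subset_span ⟨β, ?_, ?_⟩⟩
    · intro x hx
      have := h _ (Submodule.mem_map_of_mem (f := (α : V →ₗ[F] V).restrictScalars R) hx)
      simpa [β] using this
    · have h1 : (β : V →ₗ[F] V) = algebraMap R F s • (α : V →ₗ[F] V) := by
        ext x; simp [β]
      have h2 : LinearMap.det (α : V →ₗ[F] V) = b.det c := Module.Basis.det_basis c b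
      rw [h1, LinearMap.det_smul, h2, Module.finrank_eq_card_basis b, Algebra.smul_def, map_pow]

end LocalRing

end Paper

namespace Paper

section Smith

variable {R F V : Type*} [CommRing R] [IsDedekindDomain R] [Field F] [Algebra R F]
  [IsFractionRing R F] [AddCommGroup V] [Module F V] [Module R V] [IsScalarTower R F V]

instance isPrincipalIdealRing_intAt (p : Ideal R) [p.IsMaximal] [hp : NeZero p] :
    IsPrincipalIdealRing (intAt F p) := by
  have : IsLocalization.AtPrime (intAt F p) p :=
    Localization.subalgebra.isLocalization_ofField F p.primeCompl _
  have := IsLocalization.AtPrime.isDiscreteValuationRing_of_dedekind_domain R hp.out (intAt F p)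
  infer_instance

theorem mem_intAt_or_inv_mem (p : Ideal R) [p.IsMaximal] [hp : NeZero p] (x : F) :
    x ∈ intAt F p ∨ x⁻¹ ∈ intAt F p := by
  have : IsLocalization.AtPrime (intAt F p) p :=
    Localization.subalgebra.isLocalization_ofField F p.primeCompl _
  have := IsLocalization.AtPrime.isDiscreteValuationRing_of_dedekind_domain R hp.out (intAt F p)
  rcases (ValuationRing.iff_isInteger_or_isInteger (intAt F p) F).1 inferInstance x with h | h
  · obtain ⟨y, hy⟩ := h
    exact Or.inl (hy ▸ y.2)
  · obtain ⟨y, hy⟩ := h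
    exact Or.inr (hy ▸ y.2)

variable {p : Ideal R} [p.IsMaximal] {L M N : Submodule R V}

theorem mem_span_intAt_iff {x : V} :
    x ∈ Submodule.span (intAt F p) (L : Set V) ↔ x ∈ locAt p L := by
  constructor
  · intro h
    induction h using Submodule.span_induction with
    | mem x h => exact le_locAt h
    | zero => exact zero_mem _
    | add x y _ _ hx hy => exact add_mem hx hy
    | smul a x _ hx => exact smul_mem_locAt a.2 hx
  · rintro ⟨s, hs, h⟩
    have h1 : x = (⟨_, inv_mem_intAt (F := F) hs⟩ : intAt F p) • (s • x) := by
      rw [Subalgebra.smul_def, ← algebraMap_smul F s x, smul_smul,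
        inv_mul_cancel₀ (algebraMap_ne_zero_of_notMem hs), one_smul]
    rw [h1]
    exact Submodule.smul_mem _ _ (Submodule.subset_span h)

theorem isLattice_span_intAt (hL : IsLat R F V L) :
    Submodule.IsLattice F (Submodule.span (intAt F p) (L : Set V)) where
  fg := by
    obtain ⟨S, hS⟩ := hL.1
    refine ⟨S, ?_⟩
    rw [← hS, ← Submodule.span_span_of_tower R (intAt F p) (S : Set V)]
  span_eq_top := by
    rw [Submodule.span_span_of_tower]
    exact hL.2

theorem mem_iff_repr_mem_of_basis {A : Subalgebra R F} {ι : Type*} [Fintype ι]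
    {X : Submodule A V} (β : Module.Basis ι A X)
    (b : Module.Basis ι F V) (h : ∀ i, b i = β i) {x : V} :
    x ∈ X ↔ ∀ i, b.repr x i ∈ A := by
  constructor
  · intro hx i
    have h1 : x = ∑ j, (β.repr ⟨x, hx⟩ j : F) • b j := by
      have := congrArg Subtype.val (β.sum_repr ⟨x, hx⟩)
      rw [Submodule.coe_sum] at this
      simp only [h]
      exact this.symm
    rw [h1, Module.Basis.repr_sum_self]
    exact Subtype.prop _
  · intro hx
    rw [← b.sum_repr x]
    refine sum_mem fun i _ => ?_
    rw [h]
    exact X.smul_mem (⟨_, hx i⟩ : A) (β i).2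

/-- Simultaneous local diagonalization of two lattices. -/
theorem exists_isLocBasis_smith (p : Ideal R) [p.IsMaximal] [Module.Finite F V] [NeZero p]
    (hL : IsLat R F V L) (hM : IsLat R F V M) :
    ∃ (b : Module.Basis (Fin (Module.finrank F V)) F V) (w : Fin (Module.finrank F V) → Fˣ),
      IsLocBasis p b L ∧ IsLocBasis p (b.unitsSMul w) M := by
  classical
  set A := intAt F p with hA
  let LA := Submodule.span A (L : Set V)
  let MA := Submodule.span A (M : Set V)
  have hLA : Submodule.IsLattice F LA := isLattice_span_intAt hL
  have hMA : Submodule.IsLattice F MA := isLattice_span_intAt hM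
  have hrL : Module.finrank A LA = Module.finrank F V :=
    congrArg Cardinal.toNat (Submodule.IsLattice.rank' F LA)
  have hrM : Module.finrank A MA = Module.finrank F V :=
    congrArg Cardinal.toNat (Submodule.IsLattice.rank' F MA)
  let b0 : Module.Basis (Fin (Module.finrank F V)) A LA := Module.finBasisOfFinrankEq A LA hrL
  obtain ⟨a, ha0, haM⟩ : ∃ a : A, (a : F) ≠ 0 ∧ ∀ x ∈ MA, a • x ∈ LA := by
    obtain ⟨S, hS⟩ := hM.1
    let b1 := b0.extendOfIsLattice F
    obtain ⟨⟨a, ha⟩, h⟩ := IsLocalization.exist_integer_multiples (nonZeroDivisors A)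
      (S ×ˢ (Finset.univ : Finset (Fin (Module.finrank F V)))) (fun q => b1.repr q.1 q.2)
    refine ⟨a, fun h0 => nonZeroDivisors.ne_zero ha (Subtype.ext h0), fun x hx => ?_⟩
    have hle : MA ≤ LA.comap (LinearMap.lsmul A V a) := by
      have : MA = Submodule.span A (S : Set V) := by
        simp only [MA]
        rw [← hS, Submodule.span_span_of_tower]
      rw [this]
      refine Submodule.span_le.2 fun y hy => ?_
      change a • y ∈ LA
      rw [mem_iff_repr_mem_of_basis b0 b1 fun i => b0.extendOfIsLattice_apply F i]
      intro i
      obtain ⟨c, hc⟩ := h (y, i) (Finset.mem_product.2 ⟨hy, Finset.mem_univ _⟩)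
      have : b1.repr (a • y) i = (a : F) * b1.repr y i := by
        rw [Subalgebra.smul_def, map_smul, Finsupp.smul_apply, smul_eq_mul]
      rw [this]
      have h3 : (c : F) = (a : F) * b1.repr y i := hc
      rw [← h3]
      exact c.2
    exact hle hx
  let g : MA →ₗ[A] LA := (LinearMap.lsmul A V a).restrict haM
  have hg : Function.Injective g := by
    intro x y hxy
    have h1 : (a : F) • (x : V) = (a : F) • (y : V) := congrArg Subtype.val hxy
    exact Subtype.ext (smul_right_injective V ha0 h1)
  have hrg : Module.finrank A (LinearMap.range g) = Module.finrank A LA := by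
    rw [LinearMap.finrank_range_of_inj hg, hrL, hrM]
  obtain ⟨b', d, ab', hab⟩ := Submodule.exists_smith_normal_form_of_rank_eq b0 hrg
  have hd : ∀ i, (d i : F) ≠ 0 := by
    intro i h0
    have h1 : d i = 0 := Subtype.ext h0
    have h2 := hab i
    rw [h1, zero_smul] at h2
    exact ab'.ne_zero i (Subtype.ext h2)
  let b := b'.extendOfIsLattice F
  have hb : ∀ i, b i = b' i := fun i => b'.extendOfIsLattice_apply F i
  let w : Fin (Module.finrank F V) → Fˣ := fun i => Units.mk0 _ (hd i) / Units.mk0 _ ha0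
  refine ⟨b, w, isLocBasis_iff.2 fun x => ?_, isLocBasis_iff.2 fun x => ?_⟩
  · rw [← mem_span_intAt_iff (F := F)]
    exact mem_iff_repr_mem_of_basis b' b hb
  · rw [← mem_span_intAt_iff (F := F)]
    refine mem_iff_repr_mem_of_basis (ab'.map (LinearEquiv.ofInjective g hg).symm) _ fun i => ?_
    refine smul_right_injective V ha0 ?_
    have h1 : (a : F) • (((ab'.map (LinearEquiv.ofInjective g hg).symm) i : MA) : V) =
        ((g ((LinearEquiv.ofInjective g hg).symm (ab' i)) : LA) : V) := by
      rw [Module.Basis.map_apply]; rfl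
    have h2 : g ((LinearEquiv.ofInjective g hg).symm (ab' i)) = d i • b' i := by
      rw [← hab i]
      exact congrArg Subtype.val ((LinearEquiv.ofInjective g hg).apply_symm_apply (ab' i))
    have h3 : ((d i • b' i : LA) : V) = (d i : F) • b i := by rw [hb]; rfl
    change (a : F) • (b.unitsSMul w i) = (a : F) • _
    rw [h1, h2, h3, Module.Basis.unitsSMul_apply, Units.smul_def, smul_smul]
    congr 1
    simp only [w, Units.val_div_eq_div_val, Units.val_mk0]
    field_simp

theorem exists_isLocBasis [Module.Finite F V] (p : Ideal R) [p.IsMaximal] [NeZero p]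
    (hL : IsLat R F V L) :
    ∃ b : Module.Basis (Fin (Module.finrank F V)) F V, IsLocBasis p b L := by
  obtain ⟨b, w, hb, -⟩ := exists_isLocBasis_smith p hL hL
  exact ⟨b, hb⟩

/-- A local basis can be chosen inside the lattice. -/
theorem exists_isLocBasis_mem [Module.Finite F V] (p : Ideal R) [p.IsMaximal] [NeZero p]
    (hL : IsLat R F V L) :
    ∃ b : Module.Basis (Fin (Module.finrank F V)) F V, IsLocBasis p b L ∧ ∀ i, b i ∈ L := by
  obtain ⟨b, hb⟩ := exists_isLocBasis p hL
  obtain ⟨s, hs, h⟩ := hb.exists_smul_basis_mem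
  have hs0 := algebraMap_ne_zero_of_notMem (F := F) hs
  have hbs : ∀ i, b.unitsSMul (fun _ => Units.mk0 _ hs0) i = s • b i := fun i => by
    rw [Module.Basis.unitsSMul_apply, Units.smul_def, Units.val_mk0, algebraMap_smul]
  refine ⟨b.unitsSMul fun _ => Units.mk0 _ hs0, .of_le (fun i => ?_) ?_, fun i => ?_⟩
  · rw [hbs]; exact le_locAt (h i)
  · refine le_locAt.trans (hb.le.trans (locAt_le_iff.2 (Submodule.span_le.2 ?_)))
    rintro _ ⟨i, rfl⟩
    exact ⟨s, hs, Submodule.subset_span ⟨i, hbs i⟩⟩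
  · rw [hbs]; exact h i

theorem IsLocBasis.span_eq_top {ι : Type*} [Fintype ι] {b : Module.Basis ι F V}
    (hb : IsLocBasis p b L) : Submodule.span F (L : Set V) = ⊤ := by
  obtain ⟨s, hs, h⟩ := hb.exists_smul_basis_mem
  rw [eq_top_iff, ← b.span_eq, Submodule.span_le]
  rintro _ ⟨i, rfl⟩
  have hs0 := algebraMap_ne_zero_of_notMem (F := F) hs
  have : b i = (algebraMap R F s)⁻¹ • (s • b i) := by
    rw [← algebraMap_smul F s, smul_smul, inv_mul_cancel₀ hs0, one_smul]
  rw [this]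
  exact Submodule.smul_mem _ _ (Submodule.subset_span (h i))

theorem fg_of_le (hM : M.FG) (h : L ≤ M) : L.FG := by
  have := isNoetherian_of_fg_of_noetherian M hM
  exact Submodule.FG.of_le_of_isNoetherian h

theorem IsLat.of_le_of_fg (hL : IsLat R F V L) (h : L ≤ M) (hM : M.FG) : IsLat R F V M :=
  ⟨hM, eq_top_iff.2 (hL.2.ge.trans (Submodule.span_mono h))⟩

theorem IsLat.sup (hL : IsLat R F V L) (hM : M.FG) : IsLat R F V (L ⊔ M) :=
  hL.of_le_of_fg le_sup_left (hL.1.sup hM)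

theorem exists_isMaximal_neZero (hR : ¬ IsField R) : ∃ p : Ideal R, p.IsMaximal ∧ NeZero p := by
  obtain ⟨p, hp⟩ := Ideal.exists_maximal R
  exact ⟨p, hp, ⟨Ring.ne_bot_of_isMaximal_of_not_isField hp hR⟩⟩

/-- Local bases of the intersection and the sum of two lattices. -/
theorem exists_isLocBasis_inf_sup [Module.Finite F V] (p : Ideal R) [p.IsMaximal] [NeZero p]
    (hL : IsLat R F V L) (hM : IsLat R F V M) :
    ∃ (b : Module.Basis (Fin (Module.finrank F V)) F V) (u w : Fin (Module.finrank F V) → Fˣ),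
      IsLocBasis p b L ∧ IsLocBasis p (b.unitsSMul (u * w)) M ∧
      IsLocBasis p (b.unitsSMul u) (L ⊓ M) ∧ IsLocBasis p (b.unitsSMul w) (L ⊔ M) := by
  classical
  obtain ⟨b, c, hb, hc⟩ := exists_isLocBasis_smith p hL hM
  let u : Fin (Module.finrank F V) → Fˣ := fun i => if (c i : F) ∈ intAt F p then c i else 1
  let w : Fin (Module.finrank F V) → Fˣ := fun i => if (c i : F) ∈ intAt F p then 1 else c i
  have huw : u * w = c := by
    funext i; simp only [Pi.mul_apply, u, w]; split_ifs <;> simp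
  have hrepr : ∀ (v : Fin (Module.finrank F V) → Fˣ) (x : V) i,
      (b.unitsSMul v).repr x i = (v i : F)⁻¹ * b.repr x i := fun v x i => by
    rw [Module.Basis.repr_unitsSMul, Units.smul_def, smul_eq_mul, Units.val_inv_eq_inv_val]
  refine ⟨b, u, w, hb, huw ▸ hc, isLocBasis_iff.2 fun x => ?_, .of_le (fun i => ?_) ?_⟩
  · rw [locAt_inf, Submodule.mem_inf, hb.mem_iff, hc.mem_iff, ← forall_and]
    refine forall_congr' fun i => ?_
    rw [hrepr, hrepr]
    by_cases h : (c i : F) ∈ intAt F p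
    · simp only [u, if_pos h]
      refine ⟨fun h => h.2, fun h' => ⟨?_, h'⟩⟩
      have := mul_mem h h'
      rwa [mul_inv_cancel_left₀ (c i).ne_zero] at this
    · have h' := (mem_intAt_or_inv_mem p (c i : F)).resolve_left h
      simp only [u, if_neg h, Units.val_one, inv_one, one_mul]
      exact ⟨fun h => h.1, fun hx => ⟨hx, mul_mem h' hx⟩⟩
  · by_cases h : (c i : F) ∈ intAt F p
    · simp only [w, Module.Basis.unitsSMul_apply, if_pos h, one_smul]
      exact locAt_mono le_sup_left (hb.self_mem i)
    · have := hc.self_mem i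
      simp only [w, Module.Basis.unitsSMul_apply, if_neg h]
      rw [Module.Basis.unitsSMul_apply] at this
      exact locAt_mono le_sup_right this
  · refine sup_le (fun x hx => ?_) (fun x hx => ?_)
    · rw [mem_locAt_span_iff]
      intro i
      have h1 := hb.mem_iff.1 (le_locAt hx) i
      rw [hrepr]
      by_cases h : (c i : F) ∈ intAt F p
      · simpa only [w, if_pos h, Units.val_one, inv_one, one_mul] using h1
      · have h' := (mem_intAt_or_inv_mem p (c i : F)).resolve_left h
        simp only [w, if_neg h]
        exact mul_mem h' h1
    · rw [mem_locAt_span_iff]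
      intro i
      have h1 := hc.mem_iff.1 (le_locAt hx) i
      rw [hrepr] at h1 ⊢
      by_cases h : (c i : F) ∈ intAt F p
      · simp only [w, if_pos h, Units.val_one, inv_one, one_mul]
        have := mul_mem h h1
        rwa [mul_inv_cancel_left₀ (c i).ne_zero] at this
      · simpa only [w, if_neg h] using h1

theorem IsLat.inf [Module.Finite F V] (hR : ¬ IsField R) (hL : IsLat R F V L)
    (hM : IsLat R F V M) : IsLat R F V (L ⊓ M) := by
  obtain ⟨p, _, _⟩ := exists_isMaximal_neZero hR
  obtain ⟨b, u, w, -, -, h, -⟩ := exists_isLocBasis_inf_sup p hL hM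
  exact ⟨fg_of_le hL.1 inf_le_left, h.span_eq_top⟩

end Smith

section Index

variable {R F V : Type*} [CommRing R] [IsDedekindDomain R] [Field F] [Algebra R F]
  [IsFractionRing R F] [AddCommGroup V] [Module F V] [Module R V] [IsScalarTower R F V]
  [Module.Finite F V] {L M N : Submodule R V}

theorem latIdx_mul (hR : ¬ IsField R) (hL : IsLat R F V L) (hM : IsLat R F V M)
    (hN : IsLat R F V N) :
    latIdx R F V L M * latIdx R F V M N = latIdx R F V L N := by
  refine eq_of_locAt_eq hR fun p _ hp => ?_
  have : NeZero p := ⟨hp⟩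
  obtain ⟨b, hb⟩ := exists_isLocBasis p hL
  obtain ⟨c, hc⟩ := exists_isLocBasis p hM
  obtain ⟨d, hd⟩ := exists_isLocBasis p hN
  rw [locAt_latIdx hL.1 hb hd, locAt_mul_congr (locAt_latIdx hL.1 hb hc)
    (locAt_latIdx hM.1 hc hd), Submodule.span_mul_span, Set.singleton_mul_singleton,
    Module.Basis.det_mul_det]

theorem latIdx_self (hR : ¬ IsField R) (hL : IsLat R F V L) : latIdx R F V L L = 1 := by
  refine eq_of_locAt_eq hR fun p _ hp => ?_
  have : NeZero p := ⟨hp⟩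
  obtain ⟨b, hb⟩ := exists_isLocBasis p hL
  rw [locAt_latIdx hL.1 hb hb, Module.Basis.det_self, Submodule.one_eq_span]

theorem latIdx_le_one (hR : ¬ IsField R) (hL : IsLat R F V L) (hM : IsLat R F V M)
    (h : M ≤ L) : latIdx R F V L M ≤ 1 := by
  refine le_of_locAt_le hR fun p _ hp => ?_
  have : NeZero p := ⟨hp⟩
  obtain ⟨b, hb⟩ := exists_isLocBasis p hL
  obtain ⟨c, hc⟩ := exists_isLocBasis p hM
  rw [← locAt_le_iff, locAt_latIdx hL.1 hb hc, locAt_le_iff, Submodule.span_singleton_le_iff_mem,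
    Submodule.one_eq_span, mem_locAt_span_singleton]
  refine ⟨_, ?_, (mul_one _).symm⟩
  rw [Module.Basis.det_apply]
  refine det_mem_intAt fun i j => ?_
  rw [Module.Basis.toMatrix_apply]
  exact hb.mem_iff.1 (locAt_mono h (hc.self_mem j)) i

/-- The second isomorphism theorem for lattice indices. -/
theorem latIdx_inf_eq_latIdx_sup (hR : ¬ IsField R) (hL : IsLat R F V L) (hM : IsLat R F V M) :
    latIdx R F V L (L ⊓ M) = latIdx R F V (L ⊔ M) M := by
  refine eq_of_locAt_eq hR fun p _ hp => ?_
  have : NeZero p := ⟨hp⟩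
  obtain ⟨b, u, w, h1, h2, h3, h4⟩ := exists_isLocBasis_inf_sup p hL hM
  rw [locAt_latIdx hL.1 h1 h3, locAt_latIdx (hL.sup hM.1).1 h4 h2]
  have h5 : b.det (b.unitsSMul w) ≠ 0 := (b.isUnit_det (b.unitsSMul w)).ne_zero
  have h6 : b.det (b.unitsSMul w) * (b.unitsSMul w).det (b.unitsSMul (u * w)) =
      b.det (b.unitsSMul w) * b.det (b.unitsSMul u) := by
    rw [Module.Basis.det_mul_det]
    simp only [Module.Basis.det_unitsSMul_self, Pi.mul_apply, Units.val_mul,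
      Finset.prod_mul_distrib]
    ring
  rw [mul_left_cancel₀ h5 h6]

end Index

end Paper

namespace Paper

section Dual

variable {R F V : Type*} [CommRing R] [IsDedekindDomain R] [Field F] [Algebra R F]
  [IsFractionRing R F] [AddCommGroup V] [Module F V] [Module R V] [IsScalarTower R F V]
  {L M N : Submodule R V} {ψ : LinearMap.BilinForm F V}

theorem mem_dualLat {x : V} :
    x ∈ dualLat R F V ψ L ↔ ∀ y ∈ L, ((2 : F) • ψ) x y ∈ (algebraMap R F).range := by
  simp only [dualLat, Submodule.mem_iInf, Submodule.mem_comap]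
  rfl

theorem dualLat_anti (h : L ≤ M) : dualLat R F V ψ M ≤ dualLat R F V ψ L := by
  intro x hx
  rw [mem_dualLat] at hx ⊢
  exact fun y hy => hx y (h hy)

variable {ι : Type*} [Fintype ι] [DecidableEq ι] {p : Ideal R} [p.IsPrime]

theorem isLocBasis_dualBasis (hB : ((2 : F) • ψ).Nondegenerate) (hL : L.FG)
    {b : Module.Basis ι F V} (hb : IsLocBasis p b L) :
    IsLocBasis p (LinearMap.BilinForm.dualBasis ((2 : F) • ψ) hB b) (dualLat R F V ψ L) := by
  refine isLocBasis_iff.2 fun x => ?_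
  simp only [LinearMap.BilinForm.dualBasis_repr_apply]
  constructor
  · rintro ⟨s, hs, hx⟩ i
    rw [mem_dualLat] at hx
    obtain ⟨t, ht, hy⟩ := hb.self_mem i
    refine mem_intAt.2 ⟨s * t, p.primeCompl.mul_mem hs ht, ?_⟩
    have := hx _ hy
    rwa [← algebraMap_smul F s x, ← algebraMap_smul F t (b i), map_smul, map_smul,
      LinearMap.smul_apply, smul_smul, mul_comm, ← map_mul, algebraMap_smul] at this
  · intro h
    have h1 : L.map (((((2 : F) • ψ) x) : V →ₗ[F] F).restrictScalars R) ≤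
        locAt p (1 : Submodule R F) := by
      rintro _ ⟨y, hy, rfl⟩
      have hy' := hb.mem_iff.1 (le_locAt hy)
      rw [Submodule.one_eq_span, mem_locAt_span_singleton]
      refine ⟨_, ?_, (mul_one _).symm⟩
      rw [LinearMap.restrictScalars_apply, ← b.sum_repr y, map_sum]
      refine sum_mem fun i _ => ?_
      rw [map_smul, smul_eq_mul]
      exact mul_mem (hy' i) (h i)
    obtain ⟨s, hs, H⟩ := exists_smul_mem_of_fg (hL.map _) h1
    refine ⟨s, hs, mem_dualLat.2 fun y hy => ?_⟩
    have := H _ (Submodule.mem_map_of_mem hy)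
    rw [Submodule.mem_one] at this
    obtain ⟨r, hr⟩ := this
    refine ⟨r, ?_⟩
    rw [hr, ← algebraMap_smul F s x, map_smul, LinearMap.smul_apply, algebraMap_smul]
    rfl

theorem two_smul_apply_mem_range (hψ : ψ.IsSymm) (hL : ∀ x ∈ L, ψ x x ∈ (algebraMap R F).range)
    {x y : V} (hx : x ∈ L) (hy : y ∈ L) : ((2 : F) • ψ) x y ∈ (algebraMap R F).range := by
  have h : ((2 : F) • ψ) x y = ψ (x + y) (x + y) - ψ x x - ψ y y := by
    simp only [LinearMap.smul_apply, smul_eq_mul, map_add, LinearMap.add_apply]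
    rw [hψ.eq y x]
    ring
  rw [h]
  exact sub_mem (sub_mem (hL _ (add_mem hx hy)) (hL _ hx)) (hL _ hy)

variable [Module.Finite F V]

theorem IsLat.dualLat (hR : ¬ IsField R) (hB : ((2 : F) • ψ).Nondegenerate)
    (hL : IsLat R F V L) : IsLat R F V (dualLat R F V ψ L) := by
  classical
  obtain ⟨p, _, _⟩ := exists_isMaximal_neZero hR
  obtain ⟨b, hb, hbL⟩ := exists_isLocBasis_mem p hL
  refine ⟨?_, (isLocBasis_dualBasis hB hL.1 hb).span_eq_top⟩
  refine fg_of_le (M := Submodule.span R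
    (Set.range (LinearMap.BilinForm.dualBasis ((2 : F) • ψ) hB b)))
    (Submodule.fg_span (Set.finite_range _)) fun x hx => ?_
  rw [← (LinearMap.BilinForm.dualBasis ((2 : F) • ψ) hB b).sum_repr x]
  refine sum_mem fun i _ => ?_
  rw [LinearMap.BilinForm.dualBasis_repr_apply]
  obtain ⟨r, hr⟩ := mem_dualLat.1 hx _ (hbL i)
  rw [← hr, algebraMap_smul]
  exact Submodule.smul_mem _ _ (Submodule.subset_span (Set.mem_range_self i))

theorem latIdx_dualLat_dualLat (hR : ¬ IsField R) (hB : ((2 : F) • ψ).Nondegenerate)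
    (hL : IsLat R F V L) (hM : IsLat R F V M) :
    latIdx R F V (dualLat R F V ψ L) (dualLat R F V ψ M) = latIdx R F V M L := by
  refine eq_of_locAt_eq hR fun p _ hp => ?_
  have : NeZero p := ⟨hp⟩
  obtain ⟨b, hb⟩ := exists_isLocBasis p hL
  obtain ⟨c, hc⟩ := exists_isLocBasis p hM
  rw [locAt_latIdx (hL.dualLat hR hB).1 (isLocBasis_dualBasis hB hL.1 hb)
    (isLocBasis_dualBasis hB hM.1 hc), locAt_latIdx hM.1 hc hb]
  congr 3
  rw [Module.Basis.det_apply, Module.Basis.det_apply, ← Matrix.det_transpose]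
  congr 1
  ext i j
  rw [Matrix.transpose_apply, Module.Basis.toMatrix_apply, Module.Basis.toMatrix_apply,
    LinearMap.BilinForm.dualBasis_repr_apply]
  conv_lhs => rw [← c.sum_repr (b j)]
  simp only [map_sum, map_smul, LinearMap.BilinForm.apply_dualBasis_left, smul_eq_mul, mul_ite,
    mul_one, mul_zero, Finset.sum_ite_eq', Finset.mem_univ, if_true]

/-- Locally, `[L~/L]` is generated by the Gram determinant. -/
theorem locAt_latIdx_dualLat (hR : ¬ IsField R) (hB : ((2 : F) • ψ).Nondegenerate)
    (hL : IsLat R F V L) {b : Module.Basis ι F V} (hb : IsLocBasis p b L) :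
    locAt p (latIdx R F V (dualLat R F V ψ L) L) =
      locAt p (Submodule.span R {(Matrix.of fun i j => ((2 : F) • ψ) (b i) (b j)).det}) := by
  rw [locAt_latIdx (hL.dualLat hR hB).1 (isLocBasis_dualBasis hB hL.1 hb) hb]
  congr 3
  rw [Module.Basis.det_apply, ← Matrix.det_transpose]
  congr 1
  ext i j
  rw [Matrix.transpose_apply, Module.Basis.toMatrix_apply,
    LinearMap.BilinForm.dualBasis_repr_apply, Matrix.of_apply]

theorem latIdx_dualLat_eq_mul (hR : ¬ IsField R) (hB : ((2 : F) • ψ).Nondegenerate)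
    (hM : IsLat R F V M) (hN : IsLat R F V N) :
    latIdx R F V (dualLat R F V ψ N) N =
      latIdx R F V M N * latIdx R F V M N * latIdx R F V (dualLat R F V ψ M) M := by
  have hM' := hM.dualLat hR hB
  have hN' := hN.dualLat hR hB
  rw [← latIdx_mul hR hN' hM' hN, ← latIdx_mul hR hM' hM hN, latIdx_dualLat_dualLat hR hB hN hM]
  ring

theorem IsIntegralLat.le_dualLat (hψ : ψ.IsSymm) (hL : IsIntegralLat R F V ψ L) :
    L ≤ Paper.dualLat R F V ψ L := fun _ hx =>
  mem_dualLat.2 fun _ hy => two_smul_apply_mem_range hψ hL.2 hx hy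

theorem IsMaximalLat.inf_dualLat (hψ : ψ.IsSymm) (hL : IsIntegralLat R F V ψ L)
    (hM : IsMaximalLat R F V ψ M) : L ⊓ dualLat R F V ψ M = L ⊓ M := by
  refine le_antisymm (le_inf inf_le_left ?_) (inf_le_inf_left _ (hM.1.le_dualLat hψ))
  rintro x ⟨hxL, hxM⟩
  have hint : IsIntegralLat R F V ψ (M ⊔ Submodule.span R {x}) := by
    refine ⟨hM.1.1.sup (Submodule.fg_span_singleton x), fun z hz => ?_⟩
    obtain ⟨y, hy, w, hw, rfl⟩ := Submodule.mem_sup.1 hz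
    obtain ⟨a, rfl⟩ := Submodule.mem_span_singleton.1 hw
    have h : ψ (y + a • x) (y + a • x) = ψ y y + algebraMap R F a * ((2 : F) • ψ) x y +
        algebraMap R F a * algebraMap R F a * ψ x x := by
      rw [← algebraMap_smul F a x]
      simp only [LinearMap.smul_apply, smul_eq_mul, map_add, LinearMap.add_apply, map_smul]
      rw [hψ.eq y x]
      ring
    rw [h]
    exact add_mem (add_mem (hM.1.2 y hy) (mul_mem ⟨a, rfl⟩ (mem_dualLat.1 hxM y hy)))
      (mul_mem (mul_mem ⟨a, rfl⟩ ⟨a, rfl⟩) (hL.2 x hxL))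
  have := hM.2 _ hint le_sup_left
  rw [← this]
  exact Submodule.mem_sup_right (Submodule.mem_span_singleton_self x)

theorem IsMaximalLat.latIdx_inf_le (hR : ¬ IsField R) (hB : ((2 : F) • ψ).Nondegenerate)
    (hψ : ψ.IsSymm) (hL : IsIntegralLat R F V ψ L) (hM : IsMaximalLat R F V ψ M) :
    latIdx R F V M (L ⊓ M) ≤ latIdx R F V L (L ⊓ M) := by
  have hM' := hM.1.1.dualLat hR hB
  have hLM := hL.1.inf hR hM.1.1
  have hLM' := hLM.dualLat hR hB
  have hsup := hL.1.sup hM'.1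
  have hle : L ⊔ Paper.dualLat R F V ψ M ≤ Paper.dualLat R F V ψ (L ⊓ M) :=
    sup_le ((hL.le_dualLat hψ).trans (dualLat_anti inf_le_left)) (dualLat_anti inf_le_right)
  rw [← latIdx_dualLat_dualLat hR hB hLM hM.1.1, ← latIdx_mul hR hLM' hsup hM',
    ← latIdx_inf_eq_latIdx_sup hR hL.1 hM', hM.inf_dualLat hψ hL]
  calc _ ≤ 1 * latIdx R F V L (L ⊓ M) :=
        mul_le_mul' (latIdx_le_one hR hLM' hsup hle) le_rfl
    _ = _ := one_mul _

/-- All maximal lattices have the same discriminant. -/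
theorem IsMaximalLat.latIdx_dualLat_eq (hR : ¬ IsField R) (hB : ((2 : F) • ψ).Nondegenerate)
    (hψ : ψ.IsSymm) (hL : IsMaximalLat R F V ψ L) (hM : IsMaximalLat R F V ψ M) :
    latIdx R F V (dualLat R F V ψ L) L = latIdx R F V (dualLat R F V ψ M) M := by
  have h1 := hM.latIdx_inf_le hR hB hψ hL.1
  have h2 := hL.latIdx_inf_le hR hB hψ hM.1
  rw [inf_comm] at h2
  have hLM := hL.1.1.inf hR hM.1.1
  have h4 : latIdx R F V (L ⊓ M) L = latIdx R F V (L ⊓ M) M := by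
    have hL1 := latIdx_mul hR hLM hL.1.1 hLM
    have hM1 := latIdx_mul hR hLM hM.1.1 hLM
    have hM2 := latIdx_mul hR hM.1.1 hLM hM.1.1
    rw [latIdx_self hR hLM] at hL1 hM1
    rw [latIdx_self hR hM.1.1] at hM2
    rw [← le_antisymm h1 h2] at hL1
    calc latIdx R F V (L ⊓ M) L
        = latIdx R F V (L ⊓ M) L * (latIdx R F V M (L ⊓ M) * latIdx R F V (L ⊓ M) M) := by
          rw [hM2, mul_one]
      _ = latIdx R F V (L ⊓ M) M := by rw [← mul_assoc, hL1, one_mul]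
  rw [latIdx_dualLat_eq_mul hR hB hLM hL.1.1, latIdx_dualLat_eq_mul hR hB hLM hM.1.1, h4]

end Dual

end Paper

namespace Paper

section TernaryRelations

variable {S C : Type*} [CommRing S] [Ring C] [Algebra S C]

/-- The relations satisfied by the images in the Clifford algebra of a basis of a ternary
quadratic space. -/
structure TernaryRel (x y z : C) (a b c t u v : S) : Prop where
  xx : x * x = a • 1
  yy : y * y = b • 1
  zz : z * z = c • 1
  yx : y * x = t • 1 - x * y
  zx : z * x = u • 1 - x * z
  zy : z * y = v • 1 - y * z

/-- The generators of the even part. -/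
def evenGen (x y z : C) : Fin 4 → C := ![1, x * y, x * z, y * z]

/-- The reversals of the generators of the even part. -/
def evenGenRev (x y z : C) : Fin 4 → C := ![1, y * x, z * x, z * y]

/-- The generators of the odd part. -/
def oddGen (x y z : C) : Fin 4 → C := ![x, y, z, x * (y * z)]

/-- The Gram matrix of the ternary form. -/
def ternaryGram (a b c t u v : S) : Matrix (Fin 3) (Fin 3) S :=
  !![2 * a, t, u; t, 2 * b, v; u, v, 2 * c]

/-- The Gram matrix of the norm form on the even part. -/
def evenGram (a b c t u v : S) : Matrix (Fin 4) (Fin 4) S :=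
  !![2, t, u, v; t, 2 * (a * b), a * v, v * t - b * u; u, a * v, 2 * (a * c), c * t;
    v, v * t - b * u, c * t, 2 * (b * c)]

theorem four_mul_det_evenGram (a b c t u v : S) :
    4 * (evenGram a b c t u v).det = (ternaryGram a b c t u v).det ^ 2 := by
  simp [evenGram, ternaryGram, Matrix.det_succ_row_zero, Fin.sum_univ_succ, Fin.succAbove]
  ring

variable {x y z : C} {a b c t u v : S}

namespace TernaryRel

variable (h : TernaryRel x y z a b c t u v)
include h

theorem xx_mul (w : C) : x * (x * w) = a • w := by rw [← mul_assoc, h.xx]; simp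

theorem yy_mul (w : C) : y * (y * w) = b • w := by rw [← mul_assoc, h.yy]; simp

theorem yx_mul (w : C) : y * (x * w) = t • w - x * (y * w) := by
  rw [← mul_assoc, h.yx, sub_mul]; simp [mul_assoc]

theorem zx_mul (w : C) : z * (x * w) = u • w - x * (z * w) := by
  rw [← mul_assoc, h.zx, sub_mul]; simp [mul_assoc]

theorem zy_mul (w : C) : z * (y * w) = v • w - y * (z * w) := by
  rw [← mul_assoc, h.zy, sub_mul]; simp [mul_assoc]

theorem evenGen_mul_add (i j : Fin 4) :
    evenGen x y z i * evenGenRev x y z j + evenGen x y z j * evenGenRev x y z i =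
      evenGram a b c t u v i j • 1 := by
  fin_cases i <;> fin_cases j <;>
    simp [evenGen, evenGenRev, evenGram, mul_assoc, mul_sub, h.xx, h.yy, h.zz, h.yx, h.zx, h.zy,
      h.xx_mul, h.yy_mul, h.yx_mul, h.zx_mul, h.zy_mul, smul_sub] <;>
    module

theorem mul_oddGen_mem {w : C} (hw : w = x ∨ w = y ∨ w = z) (i : Fin 4) :
    w * oddGen x y z i ∈ Submodule.span S (Set.range (evenGen x y z)) := by
  have h0 : (1 : C) ∈ Submodule.span S (Set.range (evenGen x y z)) :=
    Submodule.subset_span ⟨0, rfl⟩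
  have h1 : x * y ∈ Submodule.span S (Set.range (evenGen x y z)) :=
    Submodule.subset_span ⟨1, rfl⟩
  have h2 : x * z ∈ Submodule.span S (Set.range (evenGen x y z)) :=
    Submodule.subset_span ⟨2, rfl⟩
  have h3 : y * z ∈ Submodule.span S (Set.range (evenGen x y z)) :=
    Submodule.subset_span ⟨3, rfl⟩
  rcases hw with rfl | rfl | rfl <;> fin_cases i <;>
    simp [oddGen, mul_sub, h.xx, h.yy, h.zz, h.yx, h.zx, h.zy,
      h.xx_mul, h.yy_mul, h.yx_mul, h.zx_mul, h.zy_mul] <;>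
    repeat' first | assumption | refine sub_mem ?_ ?_ | refine Submodule.smul_mem _ _ ?_

theorem mul_evenGen_mem {w : C} (hw : w = x ∨ w = y ∨ w = z) (i : Fin 4) :
    w * evenGen x y z i ∈ Submodule.span S (Set.range (oddGen x y z)) := by
  have h0 : x ∈ Submodule.span S (Set.range (oddGen x y z)) :=
    Submodule.subset_span ⟨0, rfl⟩
  have h1 : y ∈ Submodule.span S (Set.range (oddGen x y z)) :=
    Submodule.subset_span ⟨1, rfl⟩
  have h2 : z ∈ Submodule.span S (Set.range (oddGen x y z)) :=
    Submodule.subset_span ⟨2, rfl⟩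
  have h3 : x * (y * z) ∈ Submodule.span S (Set.range (oddGen x y z)) :=
    Submodule.subset_span ⟨3, rfl⟩
  rcases hw with rfl | rfl | rfl <;> fin_cases i <;>
    simp [evenGen, mul_sub, h.yy, h.zz, h.zy,
      h.xx_mul, h.yy_mul, h.yx_mul, h.zx_mul, h.zy_mul] <;>
    repeat' first | assumption | refine sub_mem ?_ ?_ | refine Submodule.smul_mem _ _ ?_

theorem mul_mem_sup {w m : C} (hw : w ∈ Submodule.span S {x, y, z})
    (hm : m ∈ Submodule.span S (Set.range (evenGen x y z)) ⊔
      Submodule.span S (Set.range (oddGen x y z))) :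
    w * m ∈ Submodule.span S (Set.range (evenGen x y z)) ⊔
      Submodule.span S (Set.range (oddGen x y z)) := by
  induction hw using Submodule.span_induction with
  | zero => simp
  | add w w' _ _ hw hw' => rw [add_mul]; exact add_mem hw hw'
  | smul r w _ hw => rw [smul_mul_assoc]; exact Submodule.smul_mem _ _ hw
  | mem w hw =>
    have hw : w = x ∨ w = y ∨ w = z := by simpa using hw
    rw [← Submodule.span_union] at hm
    induction hm using Submodule.span_induction with
    | zero => simp
    | add m m' _ _ hm hm' => rw [mul_add]; exact add_mem hm hm'
    | smul r w _ hw => rw [mul_smul_comm]; exact Submodule.smul_mem _ _ hw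
    | mem m hm =>
      rcases hm with ⟨i, rfl⟩ | ⟨i, rfl⟩
      · exact Submodule.mem_sup_right (h.mul_evenGen_mem hw i)
      · exact Submodule.mem_sup_left (h.mul_oddGen_mem hw i)

end TernaryRel

end TernaryRelations

end Paper

namespace Paper

section CliffordLattice

variable {R F W : Type*} [CommRing R] [Field F] [Algebra R F]
  [AddCommGroup W] [Module F W] [Module R W] [IsScalarTower R F W]
  {Q : QuadraticForm F W}

theorem TernaryRel.of_algebraMap {C : Type*} [Ring C] [Algebra F C] [Algebra R C]
    [IsScalarTower R F C] {x y z : C} {a b c t u v : R}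
    (h : TernaryRel x y z (algebraMap R F a) (algebraMap R F b) (algebraMap R F c)
      (algebraMap R F t) (algebraMap R F u) (algebraMap R F v)) :
    TernaryRel x y z a b c t u v := by
  obtain ⟨h1, h2, h3, h4, h5, h6⟩ := h
  simp only [algebraMap_smul] at h1 h2 h3 h4 h5 h6
  exact ⟨h1, h2, h3, h4, h5, h6⟩

theorem ternaryRel_ι (e : Fin 3 → W) :
    TernaryRel (CliffordAlgebra.ι Q (e 0)) (CliffordAlgebra.ι Q (e 1)) (CliffordAlgebra.ι Q (e 2))
      (Q (e 0)) (Q (e 1)) (Q (e 2)) (QuadraticMap.polar Q (e 0) (e 1))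
      (QuadraticMap.polar Q (e 0) (e 2)) (QuadraticMap.polar Q (e 1) (e 2)) := by
  have h : ∀ i j, CliffordAlgebra.ι Q (e j) * CliffordAlgebra.ι Q (e i) =
      QuadraticMap.polar Q (e i) (e j) • 1 - CliffordAlgebra.ι Q (e i) * CliffordAlgebra.ι Q (e j) := by
    intro i j
    rw [← Algebra.algebraMap_eq_smul_one, ← CliffordAlgebra.ι_mul_ι_add_swap]
    abel
  refine ⟨?_, ?_, ?_, h _ _, h _ _, h _ _⟩ <;>
    rw [CliffordAlgebra.ι_sq_scalar, Algebra.algebraMap_eq_smul_one]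

variable (Q) in
/-- The even products of three vectors in the Clifford algebra. -/
def evenVec (e : Fin 3 → W) : Fin 4 → CliffordAlgebra Q :=
  evenGen (CliffordAlgebra.ι Q (e 0)) (CliffordAlgebra.ι Q (e 1)) (CliffordAlgebra.ι Q (e 2))

variable (Q) in
/-- The odd products of three vectors in the Clifford algebra. -/
def oddVec (e : Fin 3 → W) : Fin 4 → CliffordAlgebra Q :=
  oddGen (CliffordAlgebra.ι Q (e 0)) (CliffordAlgebra.ι Q (e 1)) (CliffordAlgebra.ι Q (e 2))

theorem evenVec_mem_even (e : Fin 3 → W) (i : Fin 4) : evenVec Q e i ∈ CliffordAlgebra.even Q := by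
  fin_cases i
  · exact one_mem _
  all_goals exact CliffordAlgebra.ι_mul_ι_mem_evenOdd_zero Q _ _

theorem oddVec_mem (e : Fin 3 → W) (i : Fin 4) : oddVec Q e i ∈ CliffordAlgebra.evenOdd Q 1 := by
  fin_cases i
  any_goals exact CliffordAlgebra.ι_mem_evenOdd_one Q _
  have := CliffordAlgebra.evenOdd_mul_le Q 1 0 (Submodule.mul_mem_mul
    (CliffordAlgebra.ι_mem_evenOdd_one Q (e 0))
    (CliffordAlgebra.ι_mul_ι_mem_evenOdd_zero Q (e 1) (e 2)))
  simpa [oddVec, oddGen] using this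

theorem reverse_evenVec (e : Fin 3 → W) (i : Fin 4) :
    CliffordAlgebra.reverse (evenVec Q e i) =
      evenGenRev (CliffordAlgebra.ι Q (e 0)) (CliffordAlgebra.ι Q (e 1))
        (CliffordAlgebra.ι Q (e 2)) i := by
  fin_cases i <;> simp [evenVec, evenGen, evenGenRev]

theorem span_evenVec_le (e : Fin 3 → W) :
    Submodule.span R (Set.range (evenVec Q e)) ≤ Subalgebra.toSubmodule (evenR R F W Q) := by
  rw [Submodule.span_le]
  rintro _ ⟨i, rfl⟩
  exact evenVec_mem_even e i

/-- The even component of an even element of `span(even) ⊔ span(odd)` is the element itself. -/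
theorem mem_span_evenVec_of_mem_sup {e : Fin 3 → W} {w : CliffordAlgebra Q}
    (hw : w ∈ CliffordAlgebra.even Q)
    (h : w ∈ Submodule.span R (Set.range (evenVec Q e)) ⊔
      Submodule.span R (Set.range (oddVec Q e))) :
    w ∈ Submodule.span R (Set.range (evenVec Q e)) := by
  obtain ⟨x, hx, y, hy, rfl⟩ := Submodule.mem_sup.1 h
  have hx' : x ∈ CliffordAlgebra.even Q := span_evenVec_le e hx
  have hy1 : y ∈ CliffordAlgebra.evenOdd Q 1 := by
    have : Submodule.span R (Set.range (oddVec Q e)) ≤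
        (CliffordAlgebra.evenOdd Q 1).restrictScalars R := by
      rw [Submodule.span_le]
      rintro _ ⟨i, rfl⟩
      exact oddVec_mem e i
    exact this hy
  have hy0 : y ∈ CliffordAlgebra.evenOdd Q 0 := by
    have : y ∈ CliffordAlgebra.even Q := by simpa using sub_mem hw hx'
    exact this
  have : y = 0 := (Submodule.disjoint_def.1 (CliffordAlgebra.evenOdd_isCompl Q).disjoint) y hy0 hy1
  rwa [this, add_zero]

theorem adjoin_le_of_mul_mem {S C : Type*} [CommRing S] [Ring C] [Algebra S C] {s : Set C}
    {T : Submodule S C} (h1 : 1 ∈ T) (h : ∀ w ∈ s, ∀ m ∈ T, w * m ∈ T) :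
    Subalgebra.toSubmodule (Algebra.adjoin S s) ≤ T := by
  have key : ∀ a ∈ Algebra.adjoin S s, ∀ m ∈ T, a * m ∈ T := by
    intro a ha
    induction ha using Algebra.adjoin_induction with
    | mem x hx => exact h x hx
    | algebraMap r => intro m hm; rw [← Algebra.smul_def]; exact T.smul_mem _ hm
    | add x y _ _ hx hy => intro m hm; rw [add_mul]; exact add_mem (hx m hm) (hy m hm)
    | mul x y _ _ hx hy => intro m hm; rw [mul_assoc]; exact hx _ (hy m hm)
  intro a ha
  simpa using key a ha 1 h1

theorem toSubmodule_even_eq (e : Module.Basis (Fin 3) F W) :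
    Subalgebra.toSubmodule (CliffordAlgebra.even Q) =
      Submodule.span F (Set.range (evenVec Q e)) := by
  refine le_antisymm (fun w hw => mem_span_evenVec_of_mem_sup hw ?_) (span_evenVec_le (R := F) e)
  have htop : Subalgebra.toSubmodule (Algebra.adjoin F (Set.range (CliffordAlgebra.ι Q))) ≤
      Submodule.span F (Set.range (evenVec Q e)) ⊔ Submodule.span F (Set.range (oddVec Q e)) := by
    refine adjoin_le_of_mul_mem (Submodule.mem_sup_left (Submodule.subset_span ⟨0, rfl⟩)) ?_
    rintro _ ⟨x, rfl⟩ m hm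
    refine (ternaryRel_ι (Q := Q) e).mul_mem_sup ?_ hm
    have hx : x ∈ Submodule.span F (Set.range e) := by rw [e.span_eq]; trivial
    have := Submodule.mem_map_of_mem (f := CliffordAlgebra.ι Q) hx
    rw [Submodule.map_span] at this
    refine Submodule.span_mono ?_ this
    rintro _ ⟨_, ⟨i, rfl⟩, rfl⟩
    fin_cases i <;> simp
  rw [CliffordAlgebra.adjoin_range_ι] at htop
  exact htop trivial

variable {p : Ideal R} [p.IsPrime] {N : Submodule R W}

theorem cliffordOrder_le_locAt {e : Fin 3 → W} {a b c t u v : R}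
    (h : TernaryRel (CliffordAlgebra.ι Q (e 0)) (CliffordAlgebra.ι Q (e 1))
      (CliffordAlgebra.ι Q (e 2)) a b c t u v)
    (hN : N ≤ locAt p (Submodule.span R (Set.range e))) :
    Subalgebra.toSubmodule (cliffordOrder R F W Q N) ≤
      locAt p (Submodule.span R (Set.range (evenVec Q e)) ⊔
        Submodule.span R (Set.range (oddVec Q e))) := by
  refine adjoin_le_of_mul_mem
    (le_locAt (Submodule.mem_sup_left (Submodule.subset_span ⟨0, rfl⟩))) ?_
  rintro _ ⟨x, hx, rfl⟩ m ⟨r, hr, hm⟩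
  obtain ⟨s, hs, hx⟩ := hN hx
  refine ⟨s * r, p.primeCompl.mul_mem hs hr, ?_⟩
  have h1 : (s * r) • (CliffordAlgebra.ι Q x * m) = (s • CliffordAlgebra.ι Q x) * (r • m) := by
    rw [smul_mul_smul_comm]
  rw [h1]
  refine h.mul_mem_sup ?_ hm
  have := Submodule.mem_map_of_mem (f := (CliffordAlgebra.ι Q).restrictScalars R) hx
  rw [Submodule.map_span, map_smul] at this
  refine Submodule.span_mono ?_ this
  rintro _ ⟨_, ⟨i, rfl⟩, rfl⟩
  fin_cases i <;> simp

variable (Q N) in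
theorem APlusSub_le_evenR : APlusSub R F W Q N ≤ Subalgebra.toSubmodule (evenR R F W Q) :=
  fun _ hx => hx.1

variable (Q N) in
theorem APlusSub_le_cliffordOrder :
    APlusSub R F W Q N ≤ Subalgebra.toSubmodule (cliffordOrder R F W Q N) :=
  fun _ hx => hx.2

theorem APlusSub_le_locAt {e : Fin 3 → W} {a b c t u v : R}
    (h : TernaryRel (CliffordAlgebra.ι Q (e 0)) (CliffordAlgebra.ι Q (e 1))
      (CliffordAlgebra.ι Q (e 2)) a b c t u v)
    (hN : N ≤ locAt p (Submodule.span R (Set.range e))) :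
    APlusSub R F W Q N ≤ locAt p (Submodule.span R (Set.range (evenVec Q e))) := by
  rintro x ⟨hx, hx'⟩
  obtain ⟨s, hs, hsx⟩ := cliffordOrder_le_locAt h hN hx'
  exact ⟨s, hs, mem_span_evenVec_of_mem_sup ((evenR R F W Q).smul_mem hx s) hsx⟩

theorem ι_mem_cliffordOrder {x : W} (hx : x ∈ N) :
    CliffordAlgebra.ι Q x ∈ cliffordOrder R F W Q N :=
  Algebra.subset_adjoin ⟨x, hx, rfl⟩

theorem evenVec_mem_APlusSub {e : Fin 3 → W} (he : ∀ i, e i ∈ N) (i : Fin 4) :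
    evenVec Q e i ∈ APlusSub R F W Q N := by
  have h0 : evenVec Q e i ∈ Subalgebra.toSubmodule (evenR R F W Q) :=
    span_evenVec_le e (Submodule.subset_span ⟨i, rfl⟩)
  refine Algebra.mem_inf.2 ⟨(Subalgebra.mem_toSubmodule _).1 h0, ?_⟩
  have h i := ι_mem_cliffordOrder (Q := Q) (he i)
  fin_cases i
  · exact one_mem (cliffordOrder R F W Q N)
  · exact mul_mem (h 0) (h 1)
  · exact mul_mem (h 0) (h 2)
  · exact mul_mem (h 1) (h 2)

variable (Q N) in
/-- The sum of the scalars and the vectors of `N` in the Clifford algebra. -/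
def scalarVec : Submodule R (CliffordAlgebra Q) :=
  1 ⊔ N.map ((CliffordAlgebra.ι Q).restrictScalars R)

theorem span_sup_span_le_scalarVec_pow {e : Fin 3 → W} (he : ∀ i, e i ∈ N) :
    Submodule.span R (Set.range (evenVec Q e)) ⊔ Submodule.span R (Set.range (oddVec Q e)) ≤
      scalarVec Q N ^ 3 := by
  have h0 : (1 : CliffordAlgebra Q) ∈ scalarVec Q N :=
    Submodule.mem_sup_left (Submodule.one_le.1 le_rfl)
  have h i : CliffordAlgebra.ι Q (e i) ∈ scalarVec Q N :=
    Submodule.mem_sup_right ⟨e i, he i, rfl⟩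
  have key : ∀ {x y z : CliffordAlgebra Q}, x ∈ scalarVec Q N → y ∈ scalarVec Q N →
      z ∈ scalarVec Q N → x * (y * z) ∈ scalarVec Q N ^ 3 := by
    intro x y z hx hy hz
    rw [pow_succ, pow_two, ← mul_assoc]
    exact Submodule.mul_mem_mul (Submodule.mul_mem_mul hx hy) hz
  refine sup_le (Submodule.span_le.2 ?_) (Submodule.span_le.2 ?_)
  · rintro _ ⟨i, rfl⟩
    fin_cases i
    · simpa [evenVec, evenGen] using key h0 h0 h0
    · simpa [evenVec, evenGen] using key h0 (h 0) (h 1)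
    · simpa [evenVec, evenGen] using key h0 (h 0) (h 2)
    · simpa [evenVec, evenGen] using key h0 (h 1) (h 2)
  · rintro _ ⟨i, rfl⟩
    fin_cases i
    · simpa [oddVec, oddGen] using key h0 h0 (h 0)
    · simpa [oddVec, oddGen] using key h0 h0 (h 1)
    · simpa [oddVec, oddGen] using key h0 h0 (h 2)
    · exact key (h 0) (h 1) (h 2)

theorem scalarVec_fg (hN : N.FG) : (scalarVec Q N ^ 3).FG :=
  Submodule.FG.pow (Submodule.FG.sup ⟨{1}, by simp [Submodule.one_eq_span]⟩ (hN.map _)) _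

end CliffordLattice

end Paper

namespace Paper

section NormForm

variable {F W : Type*} [Field F] [AddCommGroup W] [Module F W] {Q : QuadraticForm F W}

variable (Q) in
/-- The Gram matrix of the polar form of `Q` on three vectors. -/
def gramOf (e : Fin 3 → W) : Matrix (Fin 3) (Fin 3) F :=
  ternaryGram (Q (e 0)) (Q (e 1)) (Q (e 2)) (QuadraticMap.polar Q (e 0) (e 1))
    (QuadraticMap.polar Q (e 0) (e 2)) (QuadraticMap.polar Q (e 1) (e 2))

variable (Q) in
/-- The Gram matrix of the trace form on the even products of three vectors. -/
def evenGramOf (e : Fin 3 → W) : Matrix (Fin 4) (Fin 4) F :=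
  evenGram (Q (e 0)) (Q (e 1)) (Q (e 2)) (QuadraticMap.polar Q (e 0) (e 1))
    (QuadraticMap.polar Q (e 0) (e 2)) (QuadraticMap.polar Q (e 1) (e 2))

theorem evenVec_mul_reverse_add (e : Fin 3 → W) (i j : Fin 4) :
    evenVec Q e i * CliffordAlgebra.reverse (evenVec Q e j) +
      evenVec Q e j * CliffordAlgebra.reverse (evenVec Q e i) =
      algebraMap F (CliffordAlgebra Q) (evenGramOf Q e i j) := by
  rw [reverse_evenVec, reverse_evenVec, Algebra.algebraMap_eq_smul_one]
  exact (ternaryRel_ι e).evenGen_mul_add i j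

/-- A bilinear form on the even Clifford algebra is the norm form if twice of it is the trace of
`x y*`. -/
def IsNormForm (ν : LinearMap.BilinForm F (Subalgebra.toSubmodule (CliffordAlgebra.even Q))) :
    Prop :=
  ∀ x y : Subalgebra.toSubmodule (CliffordAlgebra.even Q),
    (x : CliffordAlgebra Q) * CliffordAlgebra.reverse (y : CliffordAlgebra Q) +
      y * CliffordAlgebra.reverse (x : CliffordAlgebra Q) =
      algebraMap F (CliffordAlgebra Q) (((2 : F) • ν) x y)

variable [NeZero (2 : F)]

theorem algebraMap_clifford_injective :
    Function.Injective (algebraMap F (CliffordAlgebra Q)) := by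
  have := invertibleOfNonzero (two_ne_zero (α := F))
  exact (algebraMap F (CliffordAlgebra Q)).injective

theorem exists_isNormForm (e : Module.Basis (Fin 3) F W) :
    ∃ ν : LinearMap.BilinForm F (Subalgebra.toSubmodule (CliffordAlgebra.even Q)),
      IsNormForm ν := by
  obtain ⟨φ, hφ⟩ := (Algebra.linearMap F (CliffordAlgebra Q)).exists_leftInverse_of_injective
    (LinearMap.ker_eq_bot.2 algebraMap_clifford_injective)
  let B := (LinearMap.mul F (CliffordAlgebra Q)).compl₂ CliffordAlgebra.reverse
  let T := B + B.flip
  let V := Subalgebra.toSubmodule (CliffordAlgebra.even Q)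
  have hT : Submodule.map₂ T V V ≤ LinearMap.range (Algebra.linearMap F (CliffordAlgebra Q)) := by
    simp only [V]
    rw [toSubmodule_even_eq e, Submodule.map₂_span_span, Submodule.span_le]
    rintro _ ⟨_, ⟨i, rfl⟩, _, ⟨j, rfl⟩, rfl⟩
    exact ⟨_, (evenVec_mul_reverse_add e i j).symm⟩
  refine ⟨(2 : F)⁻¹ • (T.compr₂ φ).domRestrict₁₂ V V, fun x y => ?_⟩
  obtain ⟨c, hc⟩ := Submodule.map₂_le.1 hT x x.2 y y.2
  have h1 : φ (T x y) = c := by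
    rw [← hc]; exact LinearMap.congr_fun hφ c
  have h2 : ((2 : F) • (2 : F)⁻¹ • (T.compr₂ φ).domRestrict₁₂ V V) x y = c := by
    rw [smul_inv_smul₀ two_ne_zero]
    exact h1
  rw [h2]
  exact hc.symm

variable {ν : LinearMap.BilinForm F (Subalgebra.toSubmodule (CliffordAlgebra.even Q))}

theorem IsNormForm.apply_eq (hν : IsNormForm ν) {e : Fin 3 → W}
    {x y : Subalgebra.toSubmodule (CliffordAlgebra.even Q)} {i j : Fin 4}
    (hx : (x : CliffordAlgebra Q) = evenVec Q e i) (hy : (y : CliffordAlgebra Q) = evenVec Q e j) :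
    ((2 : F) • ν) x y = evenGramOf Q e i j := by
  apply algebraMap_clifford_injective (Q := Q)
  rw [← hν, hx, hy, evenVec_mul_reverse_add]

theorem linearIndependent_evenVec {e : Fin 3 → W} (he : (evenGramOf Q e).det ≠ 0) :
    LinearIndependent F (evenVec Q e) := by
  rw [Fintype.linearIndependent_iff]
  intro g hg
  refine fun i => congr_fun (Matrix.eq_zero_of_vecMul_eq_zero he (v := g) ?_) i
  ext j
  apply algebraMap_clifford_injective (Q := Q)
  have h1 : algebraMap F (CliffordAlgebra Q) (Matrix.vecMul g (evenGramOf Q e) j) =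
      (∑ i, g i • evenVec Q e i) * CliffordAlgebra.reverse (evenVec Q e j) +
        evenVec Q e j * CliffordAlgebra.reverse (∑ i, g i • evenVec Q e i) := by
    simp only [Matrix.vecMul, dotProduct, map_sum, map_mul, map_smul, Finset.sum_mul,
      Finset.mul_sum, ← Finset.sum_add_distrib, ← evenVec_mul_reverse_add]
    refine Finset.sum_congr rfl fun i _ => ?_
    rw [← Algebra.smul_def, smul_add, smul_mul_assoc, mul_smul_comm]
  rw [h1, hg]
  simp

theorem exists_evenBasis (e : Module.Basis (Fin 3) F W) (he : (evenGramOf Q e).det ≠ 0) :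
    ∃ b : Module.Basis (Fin 4) F (Subalgebra.toSubmodule (CliffordAlgebra.even Q)),
      ∀ i, (b i : CliffordAlgebra Q) = evenVec Q e i := by
  refine ⟨(Module.Basis.span (linearIndependent_evenVec he)).map
    (LinearEquiv.ofEq _ _ (toSubmodule_even_eq e).symm), fun i => ?_⟩
  rw [Module.Basis.map_apply]
  exact congrArg Subtype.val (Module.Basis.span_apply (linearIndependent_evenVec he) i)

theorem IsNormForm.nondegenerate (hν : IsNormForm ν) (e : Module.Basis (Fin 3) F W)
    (he : (evenGramOf Q e).det ≠ 0) : ((2 : F) • ν).Nondegenerate := by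
  obtain ⟨b, hb⟩ := exists_evenBasis e he
  rw [LinearMap.BilinForm.nondegenerate_iff_det_ne_zero b]
  convert he using 2
  ext i j
  rw [LinearMap.BilinForm.toMatrix_apply, hν.apply_eq (hb i) (hb j)]

theorem IsNormForm.comap_normDual {R : Type*} [CommRing R] [Algebra R F] [Module R W]
    [IsScalarTower R F W] (hν : IsNormForm ν) {o : Submodule R (CliffordAlgebra Q)}
    (ho : o ≤ Subalgebra.toSubmodule (evenR R F W Q)) :
    Submodule.comap ((Subalgebra.toSubmodule (CliffordAlgebra.even Q)).subtype.restrictScalars R)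
      (normDual R F W Q o) =
    dualLat R F _ ν (Submodule.comap
      ((Subalgebra.toSubmodule (CliffordAlgebra.even Q)).subtype.restrictScalars R) o) := by
  have key : ∀ x y : Subalgebra.toSubmodule (CliffordAlgebra.even Q),
      ((x : CliffordAlgebra Q) * CliffordAlgebra.reverse (y : CliffordAlgebra Q) +
        y * CliffordAlgebra.reverse (x : CliffordAlgebra Q) ∈ oneLat R F W Q ↔
      ((2 : F) • ν) x y ∈ LinearMap.range (Algebra.linearMap R F)) := by
    intro x y
    rw [hν]
    constructor
    · rintro ⟨r, hr⟩
      refine ⟨r, algebraMap_clifford_injective (Q := Q) ?_⟩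
      rw [← hr]
      exact (IsScalarTower.algebraMap_apply R F (CliffordAlgebra Q) r).symm
    · rintro ⟨r, hr⟩
      rw [← hr]
      exact ⟨r, IsScalarTower.algebraMap_apply R F (CliffordAlgebra Q) r⟩
  ext x
  simp only [normDual, dualLat, Submodule.mem_iInf, Submodule.mem_comap, Submodule.mem_inf]
  constructor
  · rintro ⟨-, h⟩ y hy
    exact (key x y).1 (h y hy)
  · intro h
    exact ⟨x.2, fun y hy => (key x ⟨y, ho hy⟩).2 (h ⟨y, ho hy⟩ hy)⟩

end NormForm

end Paper

namespace Paper

section EvenOrder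

variable {R F W : Type*} [CommRing R] [IsDedekindDomain R] [Field F] [Algebra R F]
  [IsFractionRing R F] [AddCommGroup W] [Module F W] [Module R W] [IsScalarTower R F W]
  {ψ : LinearMap.BilinForm F W} {M N : Submodule R W}

variable (ψ N) in
/-- The order `A⁺(N)`, as a submodule of the even Clifford algebra. -/
def evenLat : Submodule R (Subalgebra.toSubmodule (CliffordAlgebra.even ψ.toQuadraticMap)) :=
  Submodule.comap ((Subalgebra.toSubmodule (CliffordAlgebra.even ψ.toQuadraticMap)).subtype.restrictScalars R)
    (APlusSub R F W ψ.toQuadraticMap N)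

theorem gramOf_eq (hψ : ψ.IsSymm) (e : Fin 3 → W) :
    gramOf ψ.toQuadraticMap e = Matrix.of fun i j => ((2 : F) • ψ) (e i) (e j) := by
  ext i j
  fin_cases i <;> fin_cases j <;>
    simp [gramOf, ternaryGram, LinearMap.BilinMap.polar_toQuadraticMap, hψ.eq, two_mul]
  all_goals rw [hψ.eq]

theorem det_gramOf_ne_zero (hψ : ψ.IsSymm) (hB : ((2 : F) • ψ).Nondegenerate)
    (e : Module.Basis (Fin 3) F W) : (gramOf ψ.toQuadraticMap e).det ≠ 0 := by
  rw [LinearMap.BilinForm.nondegenerate_iff_det_ne_zero e] at hB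
  convert hB using 2
  ext i j
  rw [gramOf_eq hψ, LinearMap.BilinForm.toMatrix_apply, Matrix.of_apply]

variable [NeZero (2 : F)]

theorem det_evenGramOf (Q : QuadraticForm F W) (e : Fin 3 → W) :
    (evenGramOf Q e).det = (2⁻¹ * (gramOf Q e).det) * (2⁻¹ * (gramOf Q e).det) := by
  have h := four_mul_det_evenGram (Q (e 0)) (Q (e 1)) (Q (e 2)) (QuadraticMap.polar Q (e 0) (e 1))
    (QuadraticMap.polar Q (e 0) (e 2)) (QuadraticMap.polar Q (e 1) (e 2))
  change 4 * (evenGramOf Q e).det = (gramOf Q e).det ^ 2 at h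
  have h2 : (2 : F) ≠ 0 := two_ne_zero
  field_simp
  linear_combination h

theorem det_evenGramOf_ne_zero (hψ : ψ.IsSymm) (hB : ((2 : F) • ψ).Nondegenerate)
    (e : Module.Basis (Fin 3) F W) : (evenGramOf ψ.toQuadraticMap e).det ≠ 0 := by
  have := det_gramOf_ne_zero hψ hB e
  have h2 : (2 : F)⁻¹ ≠ 0 := inv_ne_zero two_ne_zero
  rw [det_evenGramOf]
  exact mul_ne_zero (mul_ne_zero h2 this) (mul_ne_zero h2 this)

theorem IsIntegralLat.exists_ternaryRel (hψ : ψ.IsSymm) (hN : IsIntegralLat R F W ψ N)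
    {e : Fin 3 → W} (he : ∀ i, e i ∈ N) :
    ∃ a b c t u v : R, TernaryRel (CliffordAlgebra.ι ψ.toQuadraticMap (e 0))
      (CliffordAlgebra.ι ψ.toQuadraticMap (e 1)) (CliffordAlgebra.ι ψ.toQuadraticMap (e 2)) a b c t u v := by
  have hpol : ∀ i j, QuadraticMap.polar ψ.toQuadraticMap (e i) (e j) ∈ (algebraMap R F).range := by
    intro i j
    have := two_smul_apply_mem_range hψ hN.2 (he i) (he j)
    rw [LinearMap.BilinMap.polar_toQuadraticMap, hψ.eq (e j), ← two_mul]
    exact this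
  have hQ : ∀ i, ψ.toQuadraticMap (e i) ∈ (algebraMap R F).range := fun i => hN.2 _ (he i)
  obtain ⟨a, ha⟩ := hQ 0
  obtain ⟨b, hb⟩ := hQ 1
  obtain ⟨c, hc⟩ := hQ 2
  obtain ⟨t, ht⟩ := hpol 0 1
  obtain ⟨u, hu⟩ := hpol 0 2
  obtain ⟨v, hv⟩ := hpol 1 2
  refine ⟨a, b, c, t, u, v, TernaryRel.of_algebraMap (F := F) ?_⟩
  rw [ha, hb, hc, ht, hu, hv]
  exact ternaryRel_ι e

variable [Module.Finite F W]

/-- A basis of a ternary lattice at `p` gives rise to a basis of the even order at `p`. -/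
theorem IsIntegralLat.exists_isLocBasis_evenLat (hW : Module.finrank F W = 3) (hψ : ψ.IsSymm)
    (hB : ((2 : F) • ψ).Nondegenerate) (hN : IsIntegralLat R F W ψ N)
    (p : Ideal R) [p.IsMaximal] [NeZero p] :
    ∃ (e : Module.Basis (Fin 3) F W)
      (b : Module.Basis (Fin 4) F (Subalgebra.toSubmodule (CliffordAlgebra.even ψ.toQuadraticMap))),
      (∀ i, e i ∈ N) ∧ IsLocBasis p e N ∧
      (∀ i, (b i : CliffordAlgebra ψ.toQuadraticMap) = evenVec ψ.toQuadraticMap e i) ∧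
      IsLocBasis p b (evenLat ψ N) := by
  obtain ⟨e', he', heN'⟩ := exists_isLocBasis_mem p hN.1
  obtain ⟨e, he, heN⟩ : ∃ e : Module.Basis (Fin 3) F W, IsLocBasis p e N ∧ ∀ i, e i ∈ N := by
    refine ⟨e'.reindex (finCongr hW), ?_, fun i => by simp [heN']⟩
    rw [IsLocBasis, Module.Basis.range_reindex]
    exact he'
  obtain ⟨b, hb⟩ := exists_evenBasis e (det_evenGramOf_ne_zero hψ hB e)
  refine ⟨e, b, heN, he, hb, .of_le (fun i => le_locAt ?_) fun x hx => ?_⟩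
  · rw [evenLat, Submodule.mem_comap]
    have := evenVec_mem_APlusSub (Q := ψ.toQuadraticMap) heN i
    rw [← hb] at this
    exact this
  · obtain ⟨a, b', c, t, u, v, h⟩ := hN.exists_ternaryRel hψ heN
    obtain ⟨s, hs, hsx⟩ := APlusSub_le_locAt h (le_locAt.trans he.le) hx
    refine ⟨s, hs, ?_⟩
    have hrange : Set.range (evenVec ψ.toQuadraticMap e) =
        ((Subalgebra.toSubmodule (CliffordAlgebra.even ψ.toQuadraticMap)).subtype.restrictScalars R) ''
          Set.range b := by
      rw [← Set.range_comp]
      exact congrArg Set.range (funext fun i => (hb i).symm)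
    rw [hrange, ← Submodule.map_span] at hsx
    obtain ⟨y, hy, hyx⟩ := hsx
    have : y = s • x := Subtype.ext hyx
    rwa [← this]

theorem IsIntegralLat.evenLat_fg (hR : ¬ IsField R) (hW : Module.finrank F W = 3) (hψ : ψ.IsSymm)
    (hB : ((2 : F) • ψ).Nondegenerate) (hN : IsIntegralLat R F W ψ N) : (evenLat ψ N).FG := by
  refine Submodule.fg_of_fg_map_injective
    ((Subalgebra.toSubmodule (CliffordAlgebra.even ψ.toQuadraticMap)).subtype.restrictScalars R)
    Subtype.val_injective (fg_of_le (scalarVec_fg (Q := ψ.toQuadraticMap) hN.1.1) ?_)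
  refine (Submodule.map_comap_le _ _).trans ((APlusSub_le_cliffordOrder _ N).trans ?_)
  refine le_of_locAt_le hR fun p _ hp => ?_
  have : NeZero p := ⟨hp⟩
  obtain ⟨e, b, heN, he, -⟩ := hN.exists_isLocBasis_evenLat hW hψ hB p
  obtain ⟨a, b', c, t, u, v, h⟩ := hN.exists_ternaryRel hψ heN
  exact (cliffordOrder_le_locAt h (le_locAt.trans he.le)).trans
    (locAt_mono (span_sup_span_le_scalarVec_pow heN))

theorem IsIntegralLat.isLat_evenLat (hR : ¬ IsField R) (hW : Module.finrank F W = 3)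
    (hψ : ψ.IsSymm) (hB : ((2 : F) • ψ).Nondegenerate) (hN : IsIntegralLat R F W ψ N) :
    IsLat R F _ (evenLat ψ N) := by
  obtain ⟨p, _, _⟩ := exists_isMaximal_neZero hR
  obtain ⟨e, b, -, -, -, hb⟩ := hN.exists_isLocBasis_evenLat hW hψ hB p
  exact ⟨hN.evenLat_fg hR hW hψ hB, hb.span_eq_top⟩

theorem APlusDualIdx_eq_latIdx
    {ν : LinearMap.BilinForm F (Subalgebra.toSubmodule (CliffordAlgebra.even ψ.toQuadraticMap))}
    (hν : IsNormForm ν) :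
    APlusDualIdx R F W ψ N = latIdx R F _ (dualLat R F _ ν (evenLat ψ N)) (evenLat ψ N) := by
  rw [APlusDualIdx, latIdxIn, hν.comap_normDual (APlusSub_le_evenR _ N)]
  rfl

theorem IsIntegralLat.aPlusDualIdx_eq (hR : ¬ IsField R) (hW : Module.finrank F W = 3)
    (hψ : ψ.IsSymm) (hB : ((2 : F) • ψ).Nondegenerate) (hN : IsIntegralLat R F W ψ N) :
    APlusDualIdx R F W ψ N = halfDualIdx R F W ψ N * halfDualIdx R F W ψ N := by
  have hA := hN.isLat_evenLat hR hW hψ hB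
  refine eq_of_locAt_eq hR fun p _ hp => ?_
  have : NeZero p := ⟨hp⟩
  obtain ⟨e, b, heN, he, hb, hbA⟩ := hN.exists_isLocBasis_evenLat hW hψ hB p
  have : Module.Finite F (Subalgebra.toSubmodule (CliffordAlgebra.even ψ.toQuadraticMap)) :=
    Module.Finite.of_basis b
  obtain ⟨ν, hν⟩ := exists_isNormForm (Q := ψ.toQuadraticMap) e
  have hνB := hν.nondegenerate e (det_evenGramOf_ne_zero hψ hB e)
  have hhalf : locAt p (halfDualIdx R F W ψ N) =
      locAt p (Submodule.span R {2⁻¹ * (gramOf ψ.toQuadraticMap e).det}) := by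
    rw [← Set.singleton_mul_singleton, ← Submodule.span_mul_span]
    refine locAt_mul_congr rfl ?_
    rw [locAt_latIdx_dualLat hR hB hN.1 he, gramOf_eq hψ]
  rw [APlusDualIdx_eq_latIdx hν, locAt_latIdx_dualLat hR hνB hA hbA, locAt_mul_congr hhalf hhalf,
    Submodule.span_mul_span, Set.singleton_mul_singleton, ← det_evenGramOf]
  congr 4
  ext i j
  exact hν.apply_eq (hb i) (hb j)

theorem IsIntegralLat.aPlusDualIdx_eq_mul (hR : ¬ IsField R) (hW : Module.finrank F W = 3)
    (hψ : ψ.IsSymm) (hB : ((2 : F) • ψ).Nondegenerate) (hM : IsIntegralLat R F W ψ M)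
    (hN : IsIntegralLat R F W ψ N) :
    APlusDualIdx R F W ψ N =
      APlusIdx R F W ψ M N * APlusIdx R F W ψ M N * APlusDualIdx R F W ψ M := by
  obtain ⟨p, _, _⟩ := exists_isMaximal_neZero hR
  obtain ⟨e, b, -⟩ := hN.exists_isLocBasis_evenLat hW hψ hB p
  have : Module.Finite F (Subalgebra.toSubmodule (CliffordAlgebra.even ψ.toQuadraticMap)) :=
    Module.Finite.of_basis b
  obtain ⟨ν, hν⟩ := exists_isNormForm (Q := ψ.toQuadraticMap) e
  have hνB := hν.nondegenerate e (det_evenGramOf_ne_zero hψ hB e)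
  rw [APlusDualIdx_eq_latIdx hν, APlusDualIdx_eq_latIdx hν]
  exact latIdx_dualLat_eq_mul hR hνB (hM.isLat_evenLat hR hW hψ hB)
    (hN.isLat_evenLat hR hW hψ hB)

end EvenOrder

end Paper

/-- For an integral lattice `N` and maximal lattices `M, M'` in a
nondegenerate ternary quadratic space `(W,ψ)` over a number field:
`[A⁺(M)~/A⁺(M)] = (2⁻¹[M̃/M])²` is independent of the choice of `M`, and
`[A⁺(N)~/A⁺(N)] = [A⁺(M)/A⁺(N)]²·[A⁺(M)~/A⁺(M)]`. -/
theorem statement2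
    (F : Type*) [Field F] [NumberField F]
    (W : Type*) [AddCommGroup W] [Module F W]
    [Module (RingOfIntegers F) W] [IsScalarTower (RingOfIntegers F) F W]
    (hW : Module.finrank F W = 3)
    (ψ : LinearMap.BilinForm F W) (hsymm : ψ.IsSymm)
    (hnd : LinearMap.BilinForm.Nondegenerate ψ)
    (N M M' : Submodule (RingOfIntegers F) W)
    (hN : IsIntegralLat (RingOfIntegers F) F W ψ N)
    (hM : IsMaximalLat (RingOfIntegers F) F W ψ M)
    (hM' : IsMaximalLat (RingOfIntegers F) F W ψ M') :
    APlusDualIdx (RingOfIntegers F) F W ψ M =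
        halfDualIdx (RingOfIntegers F) F W ψ M * halfDualIdx (RingOfIntegers F) F W ψ M ∧
    APlusDualIdx (RingOfIntegers F) F W ψ M = APlusDualIdx (RingOfIntegers F) F W ψ M' ∧
    APlusDualIdx (RingOfIntegers F) F W ψ N =
      APlusIdx (RingOfIntegers F) F W ψ M N * APlusIdx (RingOfIntegers F) F W ψ M N *
        APlusDualIdx (RingOfIntegers F) F W ψ M := by
  have hR : ¬ IsField (RingOfIntegers F) := NumberField.RingOfIntegers.not_isField F
  have : Module.Finite F W := Module.finite_of_finrank_pos (by omega)
  have hB : ((2 : F) • ψ).Nondegenerate :=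
    ⟨fun x h => hnd.1 x fun y => by simpa using h y, fun y h => hnd.2 y fun x => by simpa using h x⟩
  refine ⟨hM.1.aPlusDualIdx_eq hR hW hsymm hB, ?_,
    IsIntegralLat.aPlusDualIdx_eq_mul hR hW hsymm hB hM.1 hN⟩
  rw [hM.1.aPlusDualIdx_eq hR hW hsymm hB, hM'.1.aPlusDualIdx_eq hR hW hsymm hB, halfDualIdx,
    halfDualIdx, IsMaximalLat.latIdx_dualLat_eq hR hB hsymm hM hM']
end
end

section
/- Let N be an integral g-lattice in a nondegenerate ternary quadratic space (W,ψ) over an algebraic number field F (or a nonarchimedean local field). Then the discriminant of the order A⁺(N) in the quaternion algebra A⁺(W) equals 2⁻¹[Ñ/N], i.e. d(A⁺(N)) = 2⁻¹[Ñ/N]. -/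
noncomputable section

namespace Paper

section Coordinates

variable {R F : Type*} [CommRing R] [Field F] [Algebra R F]

theorem isUnit_of_fg [IsDedekindDomain R] [IsFractionRing R F] {I : Submodule R F}
    (hI : I.FG) (h0 : I ≠ ⊥) : IsUnit I := by
  let J : FractionalIdeal (nonZeroDivisors R) F := ⟨I, FractionalIdeal.isFractional_of_fg hI⟩
  have hJ : J ≠ 0 := by
    rw [← FractionalIdeal.coeToSubmodule_ne_bot]
    exact h0
  have h := mul_inv_cancel₀ hJ
  refine IsUnit.of_mul_eq_one ((J⁻¹ : FractionalIdeal _ F) : Submodule R F) ?_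
  have := congrArg (fun K : FractionalIdeal (nonZeroDivisors R) F => (K : Submodule R F)) h
  rwa [FractionalIdeal.coe_mul, FractionalIdeal.coe_one] at this

theorem mem_inv_of_forall_mul_mem_one (u : (Submodule R F)ˣ) {x : F}
    (h : ∀ y ∈ (u : Submodule R F), x * y ∈ (1 : Submodule R F)) :
    x ∈ ((u⁻¹ : (Submodule R F)ˣ) : Submodule R F) := by
  have h1 : Submodule.span R {x} * (u : Submodule R F) ≤ 1 := by
    rw [Submodule.mul_le]
    intro m hm n hn
    obtain ⟨r, rfl⟩ := Submodule.mem_span_singleton.1 hm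
    rw [smul_mul_assoc]
    exact Submodule.smul_mem _ _ (h n hn)
  have h2 := mul_le_mul_left h1 ((u⁻¹ : (Submodule R F)ˣ) : Submodule R F)
  rw [mul_assoc, Units.mul_inv, mul_one, one_mul] at h2
  exact h2 (Submodule.mem_span_singleton_self x)

theorem mul_mem_one_of_mem_inv (u : (Submodule R F)ˣ) {x y : F}
    (hx : x ∈ ((u⁻¹ : (Submodule R F)ˣ) : Submodule R F)) (hy : y ∈ (u : Submodule R F)) :
    x * y ∈ (1 : Submodule R F) := by
  rw [← u.inv_mul]
  exact Submodule.mul_mem_mul hx hy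

theorem prod_mem_prod_submodule {ι : Type*} (s : Finset ι) (I : ι → Submodule R F) (x : ι → F)
    (h : ∀ i ∈ s, x i ∈ I i) : ∏ i ∈ s, x i ∈ ∏ i ∈ s, I i := by
  classical
  induction s using Finset.induction_on with
  | empty =>
    rw [Finset.prod_empty, Finset.prod_empty]
    exact Submodule.one_le.1 le_rfl
  | insert a s ha ih =>
    rw [Finset.prod_insert ha, Finset.prod_insert ha]
    exact Submodule.mul_mem_mul (h a (Finset.mem_insert_self a s))
      (ih fun i hi => h i (Finset.mem_insert_of_mem hi))

/-- Every lattice over a Dedekind domain is, in a suitable basis, a direct sum of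
fractional ideals. -/
theorem exists_basis_mem_iff [IsDedekindDomain R] [IsFractionRing R F] (n : ℕ) :
    ∀ (W : Type*) [AddCommGroup W] [Module F W] [Module R W] [IsScalarTower R F W]
      [FiniteDimensional F W] (_ : Module.finrank F W = n) (N : Submodule R W)
      (_ : IsLat R F W N),
      ∃ (b : Module.Basis (Fin n) F W) (𝔞 : Fin n → (Submodule R F)ˣ),
        ∀ x, x ∈ N ↔ ∀ i, b.repr x i ∈ (𝔞 i : Submodule R F) := by
  induction n with
  | zero =>
    intro W _ _ _ _ _ hW N _
    have : Subsingleton W := Module.finrank_zero_iff.1 hW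
    refine ⟨Module.finBasisOfFinrankEq F W hW, fun _ => 1, fun x => ?_⟩
    simp [Subsingleton.elim x 0]
  | succ n ih =>
    intro W _ _ _ _ _ hW N hN
    let φ : W →ₗ[F] F := (Module.finBasisOfFinrankEq F W hW).coord 0
    have hφ : φ (Module.finBasisOfFinrankEq F W hW 0) = 1 := by simp [φ]
    let I : Submodule R F := N.map (φ.restrictScalars R)
    have hmemI : ∀ x ∈ N, φ x ∈ I := fun x hx =>
      Submodule.mem_map_of_mem (f := φ.restrictScalars R) hx
    have hI0 : I ≠ ⊥ := by
      intro h
      have : Submodule.span F (N : Set W) ≤ LinearMap.ker φ := by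
        rw [Submodule.span_le]
        intro x hx
        have := hmemI x hx
        rw [h] at this
        simpa using this
      rw [hN.2] at this
      have h1 := this (Submodule.mem_top (x := Module.finBasisOfFinrankEq F W hW 0))
      rw [LinearMap.mem_ker, hφ] at h1
      exact one_ne_zero h1
    obtain ⟨u, hu⟩ := isUnit_of_fg (hN.1.map _) hI0
    have key : ∀ z ∈ I * ((u⁻¹ : (Submodule R F)ˣ) : Submodule R F),
        ∃ e : W, φ e = z ∧ ∀ a ∈ I, a • e ∈ N := by
      intro z hz
      induction hz using Submodule.mul_induction_on' with
      | mem_mul_mem m hm j hj =>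
        obtain ⟨x, hx, rfl⟩ := hm
        refine ⟨j • x, by simp [mul_comm], fun a ha => ?_⟩
        obtain ⟨r, hr⟩ := Submodule.mem_one.1
          (mul_mem_one_of_mem_inv u hj (hu.symm ▸ ha : a ∈ (u : Submodule R F)))
        rw [smul_smul, mul_comm, ← hr, algebraMap_smul]
        exact N.smul_mem r hx
      | add x _ y _ hx hy =>
        obtain ⟨e, rfl, he⟩ := hx
        obtain ⟨e', rfl, he'⟩ := hy
        exact ⟨e + e', map_add _ _ _, fun a ha => by
          rw [smul_add]; exact N.add_mem (he a ha) (he' a ha)⟩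
    rw [show I = u from hu.symm, Units.mul_inv] at key
    obtain ⟨e, he, heN⟩ := key 1 (Submodule.one_le.1 le_rfl)
    let K := LinearMap.ker φ
    have hp : ∀ x, x - φ x • e ∈ K := fun x => by simp [K, he]
    let p : W →ₗ[F] K :=
      (LinearMap.id - φ.smulRight e).codRestrict K (fun x => by simpa using hp x)
    have hpv : ∀ x, ((p x : K) : W) = x - φ x • e := fun x => rfl
    let N' : Submodule R K := N.comap (K.subtype.restrictScalars R)
    have hpN : ∀ x ∈ N, p x ∈ N' := fun x hx => by
      change ((p x : K) : W) ∈ N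
      rw [hpv]
      exact N.sub_mem hx (heN _ (hu ▸ hmemI x hx))
    have hpK : ∀ y : K, p y = y := fun y => by
      ext
      rw [hpv, LinearMap.mem_ker.1 y.2, zero_smul, sub_zero]
    have hN' : IsLat R F K N' := by
      constructor
      · refine Submodule.fg_of_fg_map_injective (K.subtype.restrictScalars R)
          Subtype.val_injective (hN.1.of_le ?_)
        exact Submodule.map_comap_le _ _
      · rw [eq_top_iff]
        intro y _
        have h1 : (y : W) ∈ Submodule.span F (N : Set W) := hN.2 ▸ Submodule.mem_top
        have h2 : Submodule.span F (N : Set W) ≤ (Submodule.span F (N' : Set K)).comap p := by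
          rw [Submodule.span_le]
          exact fun x hx => Submodule.subset_span (hpN x hx)
        have h3 := h2 h1
        rwa [Submodule.mem_comap, hpK] at h3
    have hK : Module.finrank F K = n := by
      have h1 := LinearMap.finrank_range_add_finrank_ker φ
      have h2 : LinearMap.range φ = ⊤ := by
        rw [LinearMap.range_eq_top]
        exact fun c => ⟨c • e, by simp [he]⟩
      rw [h2, finrank_top, Module.finrank_self, hW] at h1
      change 1 + Module.finrank F K = n + 1 at h1
      omega
    obtain ⟨b, 𝔞, hb⟩ := ih K hK N' hN'
    let E : W ≃ₗ[F] (Fin (n + 1) → F) :=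
      { toFun := fun x => Fin.cons (φ x) (b.equivFun (p x))
        map_add' := fun x y => by
          ext i
          refine Fin.cases ?_ (fun i => ?_) i <;> simp
        map_smul' := fun c x => by
          ext i
          refine Fin.cases ?_ (fun i => ?_) i <;> simp
        invFun := fun c => c 0 • e + (b.equivFun.symm (Fin.tail c) : K)
        left_inv := fun x => by simp [hpv]
        right_inv := fun c => by
          have h1 : ∀ y : K, φ y = 0 := fun y => LinearMap.mem_ker.1 y.2
          have h2 : p e = 0 := by ext; simp [hpv, he]
          ext i
          refine Fin.cases ?_ (fun i => ?_) i
          · simp only [Fin.cons_zero, map_add, map_smul, he, h1, smul_eq_mul, mul_one, add_zero]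
          · simp only [Fin.cons_succ, map_add, map_smul, h2, hpK, smul_zero, zero_add,
              LinearEquiv.apply_symm_apply, Fin.tail] }
    refine ⟨Module.Basis.ofEquivFun E, Fin.cons u 𝔞, fun x => ?_⟩
    have hEx : ∀ i, (Module.Basis.ofEquivFun E).repr x i = E x i := fun i => by simp
    have hE0 : E x 0 = φ x := rfl
    have hEs : ∀ i : Fin n, E x i.succ = b.repr (p x) i := fun i => rfl
    simp only [hEx]
    rw [Fin.forall_fin_succ]
    simp only [Fin.cons_zero, Fin.cons_succ, hE0, hEs]
    rw [← hb, hu]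
    refine ⟨fun hx => ⟨hmemI x hx, hpN x hx⟩, fun ⟨h1, h2⟩ => ?_⟩
    have h3 : ((p x : K) : W) ∈ N := h2
    rw [hpv] at h3
    have := N.add_mem h3 (heN _ (hu ▸ h1))
    rwa [sub_add_cancel] at this

/-- The lattice index `[L'/L]` for a lattice `L` that is a direct sum of fractional ideals and
its dual `L'` with respect to a pairing given by the functionals `f`. -/
theorem latIdx_eq_span_det_mul_prod {V ι : Type*} [AddCommGroup V] [Module F V] [Module R V]
    [IsScalarTower R F V] [Fintype ι] [DecidableEq ι] (b : Module.Basis ι F V)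
    (f : ι → V →ₗ[F] F) (𝔞 : ι → (Submodule R F)ˣ) (L L' : Submodule R V)
    (hL : ∀ x, x ∈ L ↔ ∀ i, b.repr x i ∈ (𝔞 i : Submodule R F))
    (hL' : ∀ x, x ∈ L' ↔ ∀ i, f i x ∈ (((𝔞 i)⁻¹ : (Submodule R F)ˣ) : Submodule R F))
    (hdet : (Matrix.of fun i j => f i (b j)).det ≠ 0) :
    latIdx R F V L' L = Submodule.span R {(Matrix.of fun i j => f i (b j)).det} *
      ∏ i, ((𝔞 i : Submodule R F) * (𝔞 i : Submodule R F)) := by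
  have : FiniteDimensional F V := Module.Finite.of_basis b
  let g : V →ₗ[F] V := b.equivFun.symm.toLinearMap ∘ₗ LinearMap.pi f
  have hg : ∀ x i, b.repr (g x) i = f i x := fun x i => by
    rw [← Module.Basis.equivFun_apply]
    simp only [g, LinearMap.comp_apply, LinearEquiv.coe_coe, LinearEquiv.apply_symm_apply,
      LinearMap.pi_apply]
  have hgm : LinearMap.toMatrix b b g = Matrix.of fun i j => f i (b j) := by
    ext i j
    rw [LinearMap.toMatrix_apply, hg, Matrix.of_apply]
  have hgd : LinearMap.det g = (Matrix.of fun i j => f i (b j)).det := by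
    rw [← hgm, LinearMap.det_toMatrix]
  let γ : V ≃ₗ[F] V := LinearMap.equivOfDetNeZero g (hgd ▸ hdet)
  have hγ : ∀ x, γ x = g x := fun x => rfl
  rw [← hgd]
  apply le_antisymm
  · unfold latIdx
    rw [Submodule.span_le]
    rintro d ⟨α, hα, rfl⟩
    have h1 : (α : V →ₗ[F] V) = ((γ.symm.trans α : V ≃ₗ[F] V) : V →ₗ[F] V) ∘ₗ g := by
      ext x
      simp [← hγ]
    rw [h1, LinearMap.det_comp, mul_comm _ (LinearMap.det g)]
    refine Submodule.mul_mem_mul (Submodule.mem_span_singleton_self _) ?_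
    rw [← LinearMap.det_toMatrix b, Matrix.det_apply]
    refine Submodule.sum_mem _ fun σ _ => ?_
    rw [Units.smul_def]
    refine zsmul_mem ?_ _
    have hσ : ∏ i, ((𝔞 i : Submodule R F) * (𝔞 i : Submodule R F)) =
        ∏ i, ((𝔞 (σ i) : Submodule R F) * (𝔞 i : Submodule R F)) := by
      rw [Finset.prod_mul_distrib, Finset.prod_mul_distrib,
        Equiv.prod_comp σ fun i => (𝔞 i : Submodule R F)]
    rw [hσ]
    refine prod_mem_prod_submodule _ _ _ fun j _ => ?_
    rw [LinearMap.toMatrix_apply]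
    have h2 : ∀ c ∈ (((𝔞 j)⁻¹ : (Submodule R F)ˣ) : Submodule R F),
        c * b.repr (α (γ.symm (b j))) (σ j) ∈ (𝔞 (σ j) : Submodule R F) := by
      intro c hc
      have h3 : c • γ.symm (b j) ∈ L' := by
        rw [hL']
        intro i
        rw [map_smul, ← hg, ← hγ, LinearEquiv.apply_symm_apply, b.repr_self, smul_eq_mul,
          Finsupp.single_apply]
        split_ifs with h
        · subst h
          simpa using hc
        · simp
      have h4 := (hL _).1 (hα _ h3) (σ j)
      simpa using h4
    have h5 : Submodule.span R {b.repr (α (γ.symm (b j))) (σ j)} *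
        (((𝔞 j)⁻¹ : (Submodule R F)ˣ) : Submodule R F) ≤ (𝔞 (σ j) : Submodule R F) := by
      rw [Submodule.mul_le]
      intro m hm c hc
      obtain ⟨r, rfl⟩ := Submodule.mem_span_singleton.1 hm
      rw [smul_mul_assoc, mul_comm]
      exact Submodule.smul_mem _ _ (h2 c hc)
    have h6 := mul_le_mul_left h5 (𝔞 j : Submodule R F)
    rw [mul_assoc, Units.inv_mul, mul_one] at h6
    exact h6 (Submodule.mem_span_singleton_self _)
  · simp only [Submodule.mul_eq_span_mul_set (𝔞 _ : Submodule R F)]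
    rw [Submodule.prod_span, Submodule.span_mul_span, Submodule.span_le]
    rintro _ ⟨_, rfl, z, hz, rfl⟩
    obtain ⟨c, hc, rfl⟩ := (Set.mem_fintype_prod _ _).1 hz
    by_cases h0 : ∏ i, c i = 0
    · simp [h0]
    let D : V →ₗ[F] V := Matrix.toLin b b (Matrix.diagonal c)
    have hD : LinearMap.det D = ∏ i, c i := by
      rw [LinearMap.det_toLin, Matrix.det_diagonal]
    have hDr : ∀ x i, b.repr (D x) i = c i * b.repr x i := fun x i => by
      simp only [D]
      rw [← LinearMap.toMatrix_mulVec_repr b b, LinearMap.toMatrix_toLin,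
        Matrix.mulVec_diagonal]
    let δ : V ≃ₗ[F] V := LinearMap.equivOfDetNeZero D (hD ▸ h0)
    refine Submodule.subset_span ⟨γ.trans δ, fun x hx => ?_, ?_⟩
    · rw [hL]
      intro i
      change b.repr (D (g x)) i ∈ _
      rw [hDr, hg]
      obtain ⟨y, hy, z, hz, hyz⟩ := Set.mem_mul.1 (hc i)
      rw [← hyz]
      have h1 := mul_mem_one_of_mem_inv (𝔞 i) ((hL' x).1 hx i) hz
      obtain ⟨r, hr⟩ := Submodule.mem_one.1 h1
      rw [mul_assoc, mul_comm z, ← hr, mul_comm, ← Algebra.smul_def]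
      exact Submodule.smul_mem _ _ hy
    · change LinearMap.det (D ∘ₗ g) = _
      rw [LinearMap.det_comp, hD, mul_comm]

end Coordinates

end Paper

namespace Paper

section TernaryRelations

/-- Three elements of an algebra satisfying the Clifford relations for the Gram data
`q i = ψ(eᵢ, eᵢ)`, `b i j = 2ψ(eᵢ, eⱼ)`. -/
structure TernaryRel_s3 {F A : Type*} [Field F] [Ring A] [Algebra F A] (e₀ e₁ e₂ : A)
    (q₀ q₁ q₂ b₀₁ b₀₂ b₁₂ : F) : Prop where
  sq₀ : e₀ * e₀ = q₀ • (1 : A)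
  sq₁ : e₁ * e₁ = q₁ • (1 : A)
  sq₂ : e₂ * e₂ = q₂ • (1 : A)
  comm₀₁ : e₁ * e₀ = b₀₁ • (1 : A) - e₀ * e₁
  comm₀₂ : e₂ * e₀ = b₀₂ • (1 : A) - e₀ * e₂
  comm₁₂ : e₂ * e₁ = b₁₂ • (1 : A) - e₁ * e₂

variable {F A : Type*} [Field F] [Ring A] [Algebra F A] {e₀ e₁ e₂ : A}
  {q₀ q₁ q₂ b₀₁ b₀₂ b₁₂ : F}

namespace TernaryRel_s3

variable (h : TernaryRel_s3 e₀ e₁ e₂ q₀ q₁ q₂ b₀₁ b₀₂ b₁₂)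
include h

theorem sq₀_assoc (z : A) : e₀ * (e₀ * z) = q₀ • z := by
  rw [← mul_assoc, h.sq₀, smul_one_mul]

theorem sq₁_assoc (z : A) : e₁ * (e₁ * z) = q₁ • z := by
  rw [← mul_assoc, h.sq₁, smul_one_mul]

theorem comm₀₁_assoc (z : A) : e₁ * (e₀ * z) = b₀₁ • z - e₀ * (e₁ * z) := by
  rw [← mul_assoc, h.comm₀₁, sub_mul, smul_one_mul, mul_assoc]

theorem comm₀₂_assoc (z : A) : e₂ * (e₀ * z) = b₀₂ • z - e₀ * (e₂ * z) := by
  rw [← mul_assoc, h.comm₀₂, sub_mul, smul_one_mul, mul_assoc]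

theorem comm₁₂_assoc (z : A) : e₂ * (e₁ * z) = b₁₂ • z - e₁ * (e₂ * z) := by
  rw [← mul_assoc, h.comm₁₂, sub_mul, smul_one_mul, mul_assoc]

end TernaryRel_s3

/-- The even products of three generators. -/
def evenBasis (e₀ e₁ e₂ : A) : Fin 4 → A := ![1, e₀ * e₁, e₀ * e₂, e₁ * e₂]

/-- The odd products of three generators. -/
def oddBasis (e₀ e₁ e₂ : A) : Fin 4 → A := ![e₀, e₁, e₂, e₀ * (e₁ * e₂)]

/-- The combinations of the vectors `v i` with coefficients in the modules `I i`. -/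
def coeffSpan {ι : Type*} [Fintype ι] (S : Type*) [CommRing S] [Algebra S F] [Algebra S A]
    [IsScalarTower S F A] (v : ι → A) (I : ι → Submodule S F) : Submodule S A :=
  (Submodule.pi Set.univ I).map ((Fintype.linearCombination F v).restrictScalars S)

variable {S : Type*} [CommRing S] [Algebra S F] [Algebra S A] [IsScalarTower S F A]

theorem mem_coeffSpan {ι : Type*} [Fintype ι] {v : ι → A} {I : ι → Submodule S F} {x : A} :
    x ∈ coeffSpan S v I ↔ ∃ c : ι → F, (∀ i, c i ∈ I i) ∧ ∑ i, c i • v i = x := by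
  simp [coeffSpan, Submodule.mem_map, Submodule.mem_pi, Fintype.linearCombination_apply]

/-- The coefficient modules of the even part. -/
def evenCoeff (I₀ I₁ I₂ : Submodule S F) : Fin 4 → Submodule S F :=
  ![1, I₀ * I₁, I₀ * I₂, I₁ * I₂]

/-- The coefficient modules of the odd part. -/
def oddCoeff (I₀ I₁ I₂ : Submodule S F) : Fin 4 → Submodule S F :=
  ![I₀, I₁, I₂, I₀ * (I₁ * I₂)]

theorem mul_mem_of_pairing_mem_one {I I' J : Submodule S F} {t z c : F}
    (h : ∀ x ∈ I, ∀ y ∈ I', t * (x * y) ∈ (1 : Submodule S F)) (hz : z ∈ I) (hc : c ∈ I' * J) :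
    t * (z * c) ∈ J := by
  induction hc using Submodule.mul_induction_on' with
  | mem_mul_mem m hm n hn =>
    obtain ⟨r, hr⟩ := Submodule.mem_one.1 (h z hz m hm)
    rw [show t * (z * (m * n)) = t * (z * m) * n by ring, ← hr, ← Algebra.smul_def]
    exact J.smul_mem r hn
  | add x _ y _ hx hy =>
    rw [mul_add, mul_add]
    exact J.add_mem hx hy

/-- The form with Gram data `q`, `b` is integral on `I₀ ⊕ I₁ ⊕ I₂`. -/
structure IntegralGram (I₀ I₁ I₂ : Submodule S F) (q₀ q₁ q₂ b₀₁ b₀₂ b₁₂ : F) : Prop where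
  q₀ : ∀ x ∈ I₀, ∀ y ∈ I₀, q₀ * (x * y) ∈ (1 : Submodule S F)
  q₁ : ∀ x ∈ I₁, ∀ y ∈ I₁, q₁ * (x * y) ∈ (1 : Submodule S F)
  q₂ : ∀ x ∈ I₂, ∀ y ∈ I₂, q₂ * (x * y) ∈ (1 : Submodule S F)
  b₀₁ : ∀ x ∈ I₀, ∀ y ∈ I₁, b₀₁ * (x * y) ∈ (1 : Submodule S F)
  b₀₂ : ∀ x ∈ I₀, ∀ y ∈ I₂, b₀₂ * (x * y) ∈ (1 : Submodule S F)
  b₁₂ : ∀ x ∈ I₁, ∀ y ∈ I₂, b₁₂ * (x * y) ∈ (1 : Submodule S F)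

variable {I₀ I₁ I₂ : Submodule S F}

theorem pairing_symm {I I' : Submodule S F} {t : F}
    (h : ∀ x ∈ I, ∀ y ∈ I', t * (x * y) ∈ (1 : Submodule S F)) :
    ∀ x ∈ I', ∀ y ∈ I, t * (x * y) ∈ (1 : Submodule S F) := fun x hx y hy => by
  rw [mul_comm x y]; exact h y hy x hx

theorem gen_mul_mem_odd (h : TernaryRel_s3 e₀ e₁ e₂ q₀ q₁ q₂ b₀₁ b₀₂ b₁₂)
    (hI : IntegralGram I₀ I₁ I₂ q₀ q₁ q₂ b₀₁ b₀₂ b₁₂) {z₀ z₁ z₂ : F} (hz₀ : z₀ ∈ I₀)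
    (hz₁ : z₁ ∈ I₁) (hz₂ : z₂ ∈ I₂) {x : A}
    (hx : x ∈ coeffSpan S (evenBasis e₀ e₁ e₂) (evenCoeff I₀ I₁ I₂)) :
    (z₀ • e₀ + z₁ • e₁ + z₂ • e₂) * x ∈
      coeffSpan S (oddBasis e₀ e₁ e₂) (oddCoeff I₀ I₁ I₂) := by
  obtain ⟨c, hc, rfl⟩ := mem_coeffSpan.1 hx
  have h0 : c 0 ∈ (1 : Submodule S F) := hc 0
  have h1 : c 1 ∈ I₀ * I₁ := hc 1
  have h2 : c 2 ∈ I₀ * I₂ := hc 2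
  have h3 : c 3 ∈ I₁ * I₂ := hc 3
  have h1' : c 1 ∈ I₁ * I₀ := mul_comm I₀ I₁ ▸ h1
  have h2' : c 2 ∈ I₂ * I₀ := mul_comm I₀ I₂ ▸ h2
  have h3' : c 3 ∈ I₂ * I₁ := mul_comm I₁ I₂ ▸ h3
  have hs : ∀ {J : Submodule S F} {z : F}, z ∈ J → z * c 0 ∈ J := fun {J z} hz => by
    simpa using Submodule.mul_mem_mul hz h0
  rw [mem_coeffSpan]
  refine ⟨![z₀ * c 0 - q₁ * (z₁ * c 1) - b₁₂ * (z₂ * c 1) - q₂ * (z₂ * c 2),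
    q₀ * (z₀ * c 1) + z₁ * c 0 + b₀₁ * (z₁ * c 1) + b₀₂ * (z₂ * c 1) - q₂ * (z₂ * c 3),
    q₀ * (z₀ * c 2) + b₀₁ * (z₁ * c 2) + q₁ * (z₁ * c 3) + z₂ * c 0 + b₀₂ * (z₂ * c 2)
      + b₁₂ * (z₂ * c 3),
    z₀ * c 3 - z₁ * c 2 + z₂ * c 1], ?_, ?_⟩
  · intro i
    fin_cases i
    · exact sub_mem (sub_mem (sub_mem (hs hz₀) (mul_mem_of_pairing_mem_one hI.q₁ hz₁ h1'))
        (mul_mem_of_pairing_mem_one (pairing_symm hI.b₁₂) hz₂ h1'))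
        (mul_mem_of_pairing_mem_one hI.q₂ hz₂ h2')
    · exact sub_mem (add_mem (add_mem (add_mem (mul_mem_of_pairing_mem_one hI.q₀ hz₀ h1)
        (hs hz₁)) (mul_mem_of_pairing_mem_one (pairing_symm hI.b₀₁) hz₁ h1))
        (mul_mem_of_pairing_mem_one (pairing_symm hI.b₀₂) hz₂ h1))
        (mul_mem_of_pairing_mem_one hI.q₂ hz₂ h3')
    · exact add_mem (add_mem (add_mem (add_mem (add_mem
        (mul_mem_of_pairing_mem_one hI.q₀ hz₀ h2)
        (mul_mem_of_pairing_mem_one (pairing_symm hI.b₀₁) hz₁ h2))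
        (mul_mem_of_pairing_mem_one hI.q₁ hz₁ h3)) (hs hz₂))
        (mul_mem_of_pairing_mem_one (pairing_symm hI.b₀₂) hz₂ h2))
        (mul_mem_of_pairing_mem_one (pairing_symm hI.b₁₂) hz₂ h3)
    · refine add_mem (sub_mem (Submodule.mul_mem_mul hz₀ h3) ?_) ?_
      · change _ ∈ I₀ * (I₁ * I₂)
        rw [mul_left_comm I₀]
        exact Submodule.mul_mem_mul hz₁ h2
      · change _ ∈ I₀ * (I₁ * I₂)
        rw [← mul_assoc, mul_comm _ I₂]
        exact Submodule.mul_mem_mul hz₂ h1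
  · simp only [Fin.sum_univ_four, evenBasis, oddBasis, Matrix.cons_val, add_mul, mul_add,
      smul_mul_assoc, mul_smul_comm, mul_one, h.sq₁, h.sq₂, h.comm₁₂, h.sq₀_assoc, h.sq₁_assoc,
      h.comm₀₁_assoc, h.comm₀₂_assoc, h.comm₁₂_assoc, mul_sub]
    module

theorem gen_mul_mem_even (h : TernaryRel_s3 e₀ e₁ e₂ q₀ q₁ q₂ b₀₁ b₀₂ b₁₂)
    (hI : IntegralGram I₀ I₁ I₂ q₀ q₁ q₂ b₀₁ b₀₂ b₁₂) {z₀ z₁ z₂ : F} (hz₀ : z₀ ∈ I₀)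
    (hz₁ : z₁ ∈ I₁) (hz₂ : z₂ ∈ I₂) {x : A}
    (hx : x ∈ coeffSpan S (oddBasis e₀ e₁ e₂) (oddCoeff I₀ I₁ I₂)) :
    (z₀ • e₀ + z₁ • e₁ + z₂ • e₂) * x ∈
      coeffSpan S (evenBasis e₀ e₁ e₂) (evenCoeff I₀ I₁ I₂) := by
  obtain ⟨c, hc, rfl⟩ := mem_coeffSpan.1 hx
  have h0 : c 0 ∈ I₀ * 1 := (mul_one I₀).symm ▸ hc 0
  have h1 : c 1 ∈ I₁ * 1 := (mul_one I₁).symm ▸ hc 1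
  have h2 : c 2 ∈ I₂ * 1 := (mul_one I₂).symm ▸ hc 2
  have h3 : c 3 ∈ I₀ * (I₁ * I₂) := hc 3
  have h3' : c 3 ∈ I₁ * (I₀ * I₂) := mul_left_comm I₀ I₁ I₂ ▸ h3
  have h3'' : c 3 ∈ I₂ * (I₀ * I₁) := by
    rwa [mul_comm I₂, mul_assoc]
  have hs : ∀ {J J' : Submodule S F} {z w : F}, z ∈ J → w ∈ J' → z * w ∈ J' * J :=
    fun hz hw => by rw [mul_comm]; exact Submodule.mul_mem_mul hz hw
  rw [mem_coeffSpan]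
  refine ⟨![q₀ * (z₀ * c 0) + b₀₁ * (z₁ * c 0) + q₁ * (z₁ * c 1) + b₀₂ * (z₂ * c 0)
      + b₁₂ * (z₂ * c 1) + q₂ * (z₂ * c 2),
    z₀ * c 1 - z₁ * c 0 + q₂ * (z₂ * c 3),
    z₀ * c 2 - q₁ * (z₁ * c 3) - z₂ * c 0 - b₁₂ * (z₂ * c 3),
    q₀ * (z₀ * c 3) + z₁ * c 2 + b₀₁ * (z₁ * c 3) - z₂ * c 1 + b₀₂ * (z₂ * c 3)], ?_, ?_⟩
  · intro i
    fin_cases i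
    · exact add_mem (add_mem (add_mem (add_mem (add_mem
        (mul_mem_of_pairing_mem_one hI.q₀ hz₀ h0)
        (mul_mem_of_pairing_mem_one (pairing_symm hI.b₀₁) hz₁ h0))
        (mul_mem_of_pairing_mem_one hI.q₁ hz₁ h1))
        (mul_mem_of_pairing_mem_one (pairing_symm hI.b₀₂) hz₂ h0))
        (mul_mem_of_pairing_mem_one (pairing_symm hI.b₁₂) hz₂ h1))
        (mul_mem_of_pairing_mem_one hI.q₂ hz₂ h2)
    · exact add_mem (sub_mem (Submodule.mul_mem_mul hz₀ (hc 1)) (hs hz₁ (hc 0)))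
        (mul_mem_of_pairing_mem_one hI.q₂ hz₂ h3'')
    · exact sub_mem (sub_mem (sub_mem (Submodule.mul_mem_mul hz₀ (hc 2))
        (mul_mem_of_pairing_mem_one hI.q₁ hz₁ h3')) (hs hz₂ (hc 0)))
        (mul_mem_of_pairing_mem_one (pairing_symm hI.b₁₂) hz₂ h3')
    · exact add_mem (sub_mem (add_mem (add_mem (mul_mem_of_pairing_mem_one hI.q₀ hz₀ h3)
        (Submodule.mul_mem_mul hz₁ (hc 2)))
        (mul_mem_of_pairing_mem_one (pairing_symm hI.b₀₁) hz₁ h3)) (hs hz₂ (hc 1)))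
        (mul_mem_of_pairing_mem_one (pairing_symm hI.b₀₂) hz₂ h3)
  · simp only [Fin.sum_univ_four, evenBasis, oddBasis, Matrix.cons_val, add_mul, mul_add,
      smul_mul_assoc, mul_smul_comm, mul_one, h.sq₀, h.sq₁, h.sq₂, h.comm₀₁, h.comm₀₂,
      h.comm₁₂, h.sq₀_assoc, h.sq₁_assoc, h.comm₀₁_assoc, h.comm₀₂_assoc,
      h.comm₁₂_assoc, mul_sub]
    module

theorem adjoin_le_even_sup_odd (h : TernaryRel_s3 e₀ e₁ e₂ q₀ q₁ q₂ b₀₁ b₀₂ b₁₂)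
    (hI : IntegralGram I₀ I₁ I₂ q₀ q₁ q₂ b₀₁ b₀₂ b₁₂) {s : Set A}
    (hs : ∀ x ∈ s, ∃ z₀ ∈ I₀, ∃ z₁ ∈ I₁, ∃ z₂ ∈ I₂, x = z₀ • e₀ + z₁ • e₁ + z₂ • e₂) :
    Subalgebra.toSubmodule (Algebra.adjoin S s) ≤
      coeffSpan S (evenBasis e₀ e₁ e₂) (evenCoeff I₀ I₁ I₂) ⊔
        coeffSpan S (oddBasis e₀ e₁ e₂) (oddCoeff I₀ I₁ I₂) := by
  set P := coeffSpan S (evenBasis e₀ e₁ e₂) (evenCoeff I₀ I₁ I₂) ⊔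
    coeffSpan S (oddBasis e₀ e₁ e₂) (oddCoeff I₀ I₁ I₂) with hP
  have key : ∀ x ∈ Algebra.adjoin S s, ∀ y ∈ P, x * y ∈ P := by
    intro x hx
    induction hx using Algebra.adjoin_induction with
    | mem x hx =>
      intro y hy
      obtain ⟨z₀, hz₀, z₁, hz₁, z₂, hz₂, rfl⟩ := hs x hx
      obtain ⟨u, hu, v, hv, rfl⟩ := Submodule.mem_sup.1 hy
      rw [mul_add]
      exact add_mem (Submodule.mem_sup_right (gen_mul_mem_odd h hI hz₀ hz₁ hz₂ hu))
        (Submodule.mem_sup_left (gen_mul_mem_even h hI hz₀ hz₁ hz₂ hv))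
    | algebraMap r =>
      intro y hy
      rw [← Algebra.smul_def]
      exact P.smul_mem r hy
    | add a b _ _ ha hb =>
      intro y hy
      rw [add_mul]
      exact add_mem (ha y hy) (hb y hy)
    | mul a b _ _ ha hb =>
      intro y hy
      rw [mul_assoc]
      exact ha _ (hb y hy)
  intro x hx
  have h1 : (1 : A) ∈ P := by
    refine Submodule.mem_sup_left (mem_coeffSpan.2 ⟨![1, 0, 0, 0], fun i => ?_, ?_⟩)
    · fin_cases i
      · exact Submodule.one_le.1 le_rfl
      all_goals exact zero_mem _
    · simp [Fin.sum_univ_four, evenBasis]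
  simpa using key x hx 1 h1

theorem even_le_adjoin {s : Set A} (hs₀ : ∀ z ∈ I₀, z • e₀ ∈ s) (hs₁ : ∀ z ∈ I₁, z • e₁ ∈ s)
    (hs₂ : ∀ z ∈ I₂, z • e₂ ∈ s) :
    coeffSpan S (evenBasis e₀ e₁ e₂) (evenCoeff I₀ I₁ I₂) ≤
      Subalgebra.toSubmodule (Algebra.adjoin S s) := by
  have key : ∀ {I J : Submodule S F} {u v : A}, (∀ z ∈ I, z • u ∈ s) → (∀ z ∈ J, z • v ∈ s) →
      ∀ c ∈ I * J, c • (u * v) ∈ Algebra.adjoin S s := by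
    intro I J u v hu hv c hc
    induction hc using Submodule.mul_induction_on' with
    | mem_mul_mem m hm n hn =>
      rw [← smul_mul_smul_comm]
      exact mul_mem (Algebra.subset_adjoin (hu m hm)) (Algebra.subset_adjoin (hv n hn))
    | add x _ y _ hx hy =>
      rw [add_smul]
      exact add_mem hx hy
  intro x hx
  obtain ⟨c, hc, rfl⟩ := mem_coeffSpan.1 hx
  rw [Subalgebra.mem_toSubmodule, Fin.sum_univ_four]
  refine add_mem (add_mem (add_mem ?_ (key hs₀ hs₁ _ (hc 1))) (key hs₀ hs₂ _ (hc 2)))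
    (key hs₁ hs₂ _ (hc 3))
  obtain ⟨r, hr⟩ := Submodule.mem_one.1 (hc 0)
  rw [← hr, algebraMap_smul]
  exact Subalgebra.smul_mem _ (one_mem _) r

end TernaryRelations

end Paper

namespace Paper

section Discriminant

/-- The matrix of the trace pairing `x y* + y x*` on the even products of three generators. -/
def traceMatrix {F : Type*} [Field F] (q₀ q₁ q₂ b₀₁ b₀₂ b₁₂ : F) : Matrix (Fin 4) (Fin 4) F :=
  !![2, b₀₁, b₀₂, b₁₂;
     b₀₁, 2 * q₀ * q₁, q₀ * b₁₂, b₀₁ * b₁₂ - q₁ * b₀₂;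
     b₀₂, q₀ * b₁₂, 2 * q₀ * q₂, q₂ * b₀₁;
     b₁₂, b₀₁ * b₁₂ - q₁ * b₀₂, q₂ * b₀₁, 2 * q₁ * q₂]

/-- Half the determinant of the Gram matrix of a ternary form. -/
def halfDisc {F : Type*} [Field F] (q₀ q₁ q₂ b₀₁ b₀₂ b₁₂ : F) : F :=
  4 * q₀ * q₁ * q₂ + b₀₁ * b₀₂ * b₁₂ - q₀ * b₁₂ ^ 2 - q₁ * b₀₂ ^ 2 - q₂ * b₀₁ ^ 2

theorem det_traceMatrix {F : Type*} [Field F] (q₀ q₁ q₂ b₀₁ b₀₂ b₁₂ : F) :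
    (traceMatrix q₀ q₁ q₂ b₀₁ b₀₂ b₁₂).det = halfDisc q₀ q₁ q₂ b₀₁ b₀₂ b₁₂ ^ 2 := by
  simp [traceMatrix, halfDisc, Matrix.det_succ_row_zero, Fin.sum_univ_succ, Fin.succAbove]
  ring

theorem evenBasis_mul_add {F A : Type*} [Field F] [Ring A] [Algebra F A] {e₀ e₁ e₂ : A}
    {q₀ q₁ q₂ b₀₁ b₀₂ b₁₂ : F} (h : TernaryRel_s3 e₀ e₁ e₂ q₀ q₁ q₂ b₀₁ b₀₂ b₁₂) (i j : Fin 4) :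
    evenBasis e₀ e₁ e₂ i * (![1, e₁ * e₀, e₂ * e₀, e₂ * e₁] : Fin 4 → A) j +
      evenBasis e₀ e₁ e₂ j * (![1, e₁ * e₀, e₂ * e₀, e₂ * e₁] : Fin 4 → A) i =
      traceMatrix q₀ q₁ q₂ b₀₁ b₀₂ b₁₂ i j • (1 : A) := by
  fin_cases i <;> fin_cases j <;>
  · simp [evenBasis, traceMatrix, mul_assoc, mul_sub, h.sq₀, h.sq₁, h.sq₂, h.comm₀₁, h.comm₀₂,
      h.comm₁₂, h.sq₀_assoc, h.sq₁_assoc, h.comm₀₁_assoc, h.comm₀₂_assoc,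
      h.comm₁₂_assoc]
    try module

variable {R F : Type*} [CommRing R] [Field F] [Algebra R F]

theorem span_halfDisc_mul_prod_le_one {I : Fin 3 → Submodule R F} {q₀ q₁ q₂ b₀₁ b₀₂ b₁₂ : F}
    (hI : IntegralGram (I 0) (I 1) (I 2) q₀ q₁ q₂ b₀₁ b₀₂ b₁₂) :
    Submodule.span R {halfDisc q₀ q₁ q₂ b₀₁ b₀₂ b₁₂} * ∏ i, (I i * I i) ≤ 1 := by
  simp only [Submodule.mul_eq_span_mul_set (I _)]
  rw [Submodule.prod_span, Submodule.span_mul_span, Submodule.span_le]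
  rintro _ ⟨_, rfl, z, hz, rfl⟩
  obtain ⟨c, hc, rfl⟩ := (Set.mem_fintype_prod _ _).1 hz
  obtain ⟨x₀, hx₀, y₀, hy₀, h₀⟩ := Set.mem_mul.1 (hc 0)
  obtain ⟨x₁, hx₁, y₁, hy₁, h₁⟩ := Set.mem_mul.1 (hc 1)
  obtain ⟨x₂, hx₂, y₂, hy₂, h₂⟩ := Set.mem_mul.1 (hc 2)
  have hm : ∀ {x y z : F}, x ∈ (1 : Submodule R F) → y ∈ (1 : Submodule R F) →
      z ∈ (1 : Submodule R F) → x * y * z ∈ (1 : Submodule R F) := fun {x y z} hx hy hz => by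
    simpa using Submodule.mul_mem_mul (Submodule.mul_mem_mul hx hy) hz
  have t := hm (hI.q₀ _ hx₀ _ hy₀) (hI.q₁ _ hx₁ _ hy₁) (hI.q₂ _ hx₂ _ hy₂)
  have t₁ := hm (hI.b₀₁ _ hx₀ _ hx₁) (hI.b₀₂ _ hy₀ _ hx₂) (hI.b₁₂ _ hy₁ _ hy₂)
  have t₂ := hm (hI.q₀ _ hx₀ _ hy₀) (hI.b₁₂ _ hx₁ _ hx₂) (hI.b₁₂ _ hy₁ _ hy₂)
  have t₃ := hm (hI.q₁ _ hx₁ _ hy₁) (hI.b₀₂ _ hx₀ _ hx₂) (hI.b₀₂ _ hy₀ _ hy₂)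
  have t₄ := hm (hI.q₂ _ hx₂ _ hy₂) (hI.b₀₁ _ hx₀ _ hx₁) (hI.b₀₁ _ hy₀ _ hy₁)
  have := sub_mem (sub_mem (sub_mem (add_mem (nsmul_mem t 4) t₁) t₂) t₃) t₄
  simp only [Fin.prod_univ_three, ← h₀, ← h₁, ← h₂, SetLike.mem_coe]
  convert this using 1
  rw [halfDisc, nsmul_eq_mul]
  push_cast
  ring

theorem forall_pairing_mem_one_iff {V ι : Type*} [AddCommGroup V] [Module F V] [Module R V]
    [Fintype ι] [DecidableEq ι] (b : Module.Basis ι F V) (𝔞 : ι → (Submodule R F)ˣ)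
    (L : Submodule R V) (hL : ∀ x, x ∈ L ↔ ∀ i, b.repr x i ∈ (𝔞 i : Submodule R F))
    (f : ι → F) :
    (∀ y ∈ L, ∑ i, b.repr y i * f i ∈ (1 : Submodule R F)) ↔
      ∀ i, f i ∈ (((𝔞 i)⁻¹ : (Submodule R F)ˣ) : Submodule R F) := by
  constructor
  · intro h i
    refine mem_inv_of_forall_mul_mem_one _ fun c hc => ?_
    have h1 : c • b i ∈ L := by
      rw [hL]
      intro j
      rw [map_smul, b.repr_self, Finsupp.smul_single, smul_eq_mul, mul_one, Finsupp.single_apply]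
      split_ifs with hij
      · exact hij ▸ hc
      · exact zero_mem _
    have h2 := h _ h1
    rw [map_smul, b.repr_self, Finset.sum_eq_single i] at h2
    · simpa [mul_comm] using h2
    · intro j _ hj
      simp [hj.symm]
    · simp
  · intro h y hy
    refine Submodule.sum_mem _ fun i _ => ?_
    rw [mul_comm]
    exact mul_mem_one_of_mem_inv (𝔞 i) (h i) ((hL y).1 hy i)

variable {W : Type*} [AddCommGroup W] [Module F W] [Module R W]
variable {ψ : LinearMap.BilinForm F W}

theorem ternaryRel_ι_s3 (hsymm : ψ.IsSymm) (x y z : W) :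
    TernaryRel_s3 (CliffordAlgebra.ι (LinearMap.BilinMap.toQuadraticMap ψ) x)
      (CliffordAlgebra.ι _ y) (CliffordAlgebra.ι _ z) (ψ x x) (ψ y y) (ψ z z)
      (2 * ψ x y) (2 * ψ x z) (2 * ψ y z) := by
  have hsq : ∀ x : W, CliffordAlgebra.ι (LinearMap.BilinMap.toQuadraticMap ψ) x *
      CliffordAlgebra.ι _ x = ψ x x • (1 : CliffordAlgebra _) := fun x => by
    rw [CliffordAlgebra.ι_sq_scalar, Algebra.algebraMap_eq_smul_one,
      LinearMap.BilinMap.toQuadraticMap_apply]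
  have hcomm : ∀ x y : W, CliffordAlgebra.ι (LinearMap.BilinMap.toQuadraticMap ψ) y *
      CliffordAlgebra.ι _ x = (2 * ψ x y) • (1 : CliffordAlgebra _) -
        CliffordAlgebra.ι _ x * CliffordAlgebra.ι _ y := fun x y => by
    rw [eq_sub_iff_add_eq', CliffordAlgebra.ι_mul_ι_add_swap, Algebra.algebraMap_eq_smul_one,
      LinearMap.BilinMap.polar_toQuadraticMap, hsymm.eq y x, two_mul]
  exact ⟨hsq x, hsq y, hsq z, hcomm x y, hcomm x z, hcomm y z⟩

theorem integralGram_of_isIntegralLat [IsDomain R] [IsIntegrallyClosed R] [IsFractionRing R F]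
    (hsymm : ψ.IsSymm) {N : Submodule R W}
    (hN : IsIntegralLat R F W ψ N) (b : Fin 3 → W) (I : Fin 3 → Submodule R F)
    (hb : ∀ i, ∀ c ∈ I i, c • b i ∈ N) :
    IntegralGram (I 0) (I 1) (I 2) (ψ (b 0) (b 0)) (ψ (b 1) (b 1)) (ψ (b 2) (b 2))
      (2 * ψ (b 0) (b 1)) (2 * ψ (b 0) (b 2)) (2 * ψ (b 1) (b 2)) := by
  have hN1 : ∀ x ∈ N, ψ x x ∈ (1 : Submodule R F) := fun x hx => by
    obtain ⟨r, hr⟩ := hN.2 x hx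
    exact Submodule.mem_one.2 ⟨r, hr⟩
  have hsq : ∀ i, ∀ x ∈ I i, ∀ y ∈ I i, ψ (b i) (b i) * (x * y) ∈ (1 : Submodule R F) := by
    intro i x hx y hy
    have h1 := hN1 _ (hb i x hx)
    have h2 := hN1 _ (hb i y hy)
    have h3 := Submodule.mul_mem_mul h1 h2
    rw [mul_one] at h3
    obtain ⟨r, hr⟩ := Submodule.mem_one.1 h3
    have h4 : (ψ (b i) (b i) * (x * y)) ^ 2 = algebraMap R F r := by
      rw [hr]
      simp only [map_smul, LinearMap.smul_apply, smul_eq_mul]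
      ring
    have h5 : IsIntegral R (ψ (b i) (b i) * (x * y)) :=
      IsIntegral.of_pow two_pos (h4 ▸ isIntegral_algebraMap)
    exact Submodule.mem_one.2 (IsIntegrallyClosed.algebraMap_eq_of_integral h5)
  have hpol : ∀ i j, ∀ x ∈ I i, ∀ y ∈ I j,
      2 * ψ (b i) (b j) * (x * y) ∈ (1 : Submodule R F) := by
    intro i j x hx y hy
    have h1 := sub_mem (sub_mem (hN1 _ (N.add_mem (hb i x hx) (hb j y hy)))
      (hN1 _ (hb i x hx))) (hN1 _ (hb j y hy))
    convert h1 using 1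
    simp only [map_smul, LinearMap.smul_apply, smul_eq_mul, map_add, LinearMap.add_apply,
      hsymm.eq (b j) (b i)]
    ring
  exact ⟨hsq 0, hsq 1, hsq 2, hpol 0 1, hpol 0 2, hpol 1 2⟩

end Discriminant

end Paper

namespace Paper

section Clifford

variable {R F : Type*} [CommRing R] [Field F] [Algebra R F]
variable {W : Type*} [AddCommGroup W] [Module F W] [Module R W] [IsScalarTower R F W]

theorem evenBasis_mem_even (Q : QuadraticForm F W) (x y z : W) (i : Fin 4) :
    evenBasis (CliffordAlgebra.ι Q x) (CliffordAlgebra.ι Q y) (CliffordAlgebra.ι Q z) i ∈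
      Subalgebra.toSubmodule (CliffordAlgebra.even Q) := by
  have h := CliffordAlgebra.ι_mul_ι_mem_evenOdd_zero Q
  rw [CliffordAlgebra.even_toSubmodule]
  fin_cases i
  · exact Submodule.one_le.1 (CliffordAlgebra.one_le_evenOdd_zero Q)
  · exact h x y
  · exact h x z
  · exact h y z

theorem oddBasis_mem_odd (Q : QuadraticForm F W) (x y z : W) (i : Fin 4) :
    oddBasis (CliffordAlgebra.ι Q x) (CliffordAlgebra.ι Q y) (CliffordAlgebra.ι Q z) i ∈
      CliffordAlgebra.evenOdd Q 1 := by
  have h := CliffordAlgebra.ι_mem_evenOdd_one Q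
  fin_cases i
  · exact h x
  · exact h y
  · exact h z
  · have h1 := CliffordAlgebra.evenOdd_mul_le Q 1 0
      (Submodule.mul_mem_mul (h x) (CliffordAlgebra.ι_mul_ι_mem_evenOdd_zero Q y z))
    rwa [add_zero] at h1

theorem mem_even_part_of_mem_sup {Q : QuadraticForm F W} {x y z : W} {I J : Fin 4 → Submodule R F}
    {u : CliffordAlgebra Q} (hu : u ∈ CliffordAlgebra.even Q)
    (h : u ∈ coeffSpan R (evenBasis (CliffordAlgebra.ι Q x) (CliffordAlgebra.ι Q y)
        (CliffordAlgebra.ι Q z)) I ⊔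
      coeffSpan R (oddBasis (CliffordAlgebra.ι Q x) (CliffordAlgebra.ι Q y)
        (CliffordAlgebra.ι Q z)) J) :
    u ∈ coeffSpan R (evenBasis (CliffordAlgebra.ι Q x) (CliffordAlgebra.ι Q y)
      (CliffordAlgebra.ι Q z)) I := by
  obtain ⟨p, hp, r, hr, rfl⟩ := Submodule.mem_sup.1 h
  have hpe : p ∈ CliffordAlgebra.evenOdd Q 0 := by
    obtain ⟨c, -, rfl⟩ := mem_coeffSpan.1 hp
    exact sum_mem fun i _ => Submodule.smul_mem _ _ (evenBasis_mem_even Q x y z i)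
  have hro : r ∈ CliffordAlgebra.evenOdd Q 1 := by
    obtain ⟨c, -, rfl⟩ := mem_coeffSpan.1 hr
    exact sum_mem fun i _ => Submodule.smul_mem _ _ (oddBasis_mem_odd Q x y z i)
  have hre : r ∈ CliffordAlgebra.evenOdd Q 0 := by
    have := Submodule.sub_mem (CliffordAlgebra.evenOdd Q 0) hu hpe
    rwa [add_sub_cancel_left] at this
  have hr0 : r = 0 :=
    Submodule.disjoint_def.1 (CliffordAlgebra.evenOdd_isCompl (Q := Q)).disjoint r hre hro
  rwa [hr0, add_zero]

theorem mem_APlusSub_iff {Q : QuadraticForm F W} (N : Submodule R W) (b : Module.Basis (Fin 3) F W)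
    (I : Fin 3 → Submodule R F) (hb : ∀ x, x ∈ N ↔ ∀ i, b.repr x i ∈ I i)
    {q₀ q₁ q₂ b₀₁ b₀₂ b₁₂ : F}
    (h : TernaryRel_s3 (CliffordAlgebra.ι Q (b 0)) (CliffordAlgebra.ι Q (b 1))
      (CliffordAlgebra.ι Q (b 2)) q₀ q₁ q₂ b₀₁ b₀₂ b₁₂)
    (hI : IntegralGram (I 0) (I 1) (I 2) q₀ q₁ q₂ b₀₁ b₀₂ b₁₂) (u : CliffordAlgebra Q) :
    u ∈ APlusSub R F W Q N ↔ u ∈ coeffSpan R (evenBasis (CliffordAlgebra.ι Q (b 0))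
      (CliffordAlgebra.ι Q (b 1)) (CliffordAlgebra.ι Q (b 2))) (evenCoeff (I 0) (I 1) (I 2)) := by
  constructor
  · rintro ⟨hu, hu'⟩
    refine mem_even_part_of_mem_sup hu (adjoin_le_even_sup_odd h hI ?_ hu')
    rintro _ ⟨x, hx, rfl⟩
    have hx' := (hb x).1 hx
    refine ⟨_, hx' 0, _, hx' 1, _, hx' 2, ?_⟩
    have h1 := congrArg (CliffordAlgebra.ι Q) (b.sum_repr x)
    rw [Fin.sum_univ_three, map_add, map_add, map_smul, map_smul, map_smul] at h1
    exact h1.symm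
  · intro hu
    refine ⟨?_, ?_⟩
    · obtain ⟨c, -, rfl⟩ := mem_coeffSpan.1 hu
      change _ ∈ Subalgebra.toSubmodule (CliffordAlgebra.even Q)
      exact sum_mem fun i _ => Submodule.smul_mem _ _ (evenBasis_mem_even Q _ _ _ i)
    · have hs : ∀ i, ∀ z ∈ I i, z • CliffordAlgebra.ι Q (b i) ∈
          CliffordAlgebra.ι Q '' (N : Set W) := fun i z hz => by
        refine ⟨z • b i, (hb _).2 fun j => ?_, map_smul _ _ _⟩
        rw [map_smul, b.repr_self, Finsupp.smul_single, smul_eq_mul, mul_one, Finsupp.single_apply]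
        split_ifs with hij
        · exact hij ▸ hz
        · exact zero_mem _
      exact even_le_adjoin (hs 0) (hs 1) (hs 2) hu

theorem exists_evenBasis_combination {Q : QuadraticForm F W} (b : Module.Basis (Fin 3) F W)
    {q₀ q₁ q₂ b₀₁ b₀₂ b₁₂ : F}
    (h : TernaryRel_s3 (CliffordAlgebra.ι Q (b 0)) (CliffordAlgebra.ι Q (b 1))
      (CliffordAlgebra.ι Q (b 2)) q₀ q₁ q₂ b₀₁ b₀₂ b₁₂) {u : CliffordAlgebra Q}
    (hu : u ∈ CliffordAlgebra.even Q) :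
    ∃ c : Fin 4 → F, ∑ i, c i • evenBasis (CliffordAlgebra.ι Q (b 0))
      (CliffordAlgebra.ι Q (b 1)) (CliffordAlgebra.ι Q (b 2)) i = u := by
  have hone : ∀ t : F, t ∈ (1 : Submodule F F) := fun t => Submodule.mem_one.2 ⟨t, rfl⟩
  have hI : IntegralGram (1 : Submodule F F) 1 1 q₀ q₁ q₂ b₀₁ b₀₂ b₁₂ := by
    constructor <;> exact fun _ _ _ _ => hone _
  have h1 := (mem_APlusSub_iff (R := F) ⊤ b (fun _ => 1) (by simp) h hI u).1
    ⟨hu, by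
      have h2 : cliffordOrder F F W Q ⊤ = ⊤ := by
        rw [cliffordOrder, Submodule.top_coe, Set.image_univ, CliffordAlgebra.adjoin_range_ι]
      rw [h2]
      trivial⟩
  obtain ⟨c, -, hc⟩ := mem_coeffSpan.1 h1
  exact ⟨c, hc⟩

theorem reverse_evenBasis (Q : QuadraticForm F W) (x y z : W) (i : Fin 4) :
    CliffordAlgebra.reverse (evenBasis (CliffordAlgebra.ι Q x) (CliffordAlgebra.ι Q y)
      (CliffordAlgebra.ι Q z) i) =
      (![1, CliffordAlgebra.ι Q y * CliffordAlgebra.ι Q x,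
        CliffordAlgebra.ι Q z * CliffordAlgebra.ι Q x,
        CliffordAlgebra.ι Q z * CliffordAlgebra.ι Q y] : Fin 4 → CliffordAlgebra Q) i := by
  fin_cases i <;> simp [evenBasis]

theorem traceMap_apply (Q : QuadraticForm F W) (u v : CliffordAlgebra Q) :
    traceMap R F W Q v u = u * CliffordAlgebra.reverse v + v * CliffordAlgebra.reverse u :=
  rfl

variable (R) in
theorem traceMap_sum_evenBasis {Q : QuadraticForm F W} {x y z : W} {q₀ q₁ q₂ b₀₁ b₀₂ b₁₂ : F}
    (h : TernaryRel_s3 (CliffordAlgebra.ι Q x) (CliffordAlgebra.ι Q y) (CliffordAlgebra.ι Q z)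
      q₀ q₁ q₂ b₀₁ b₀₂ b₁₂) (c d : Fin 4 → F) :
    traceMap R F W Q
      (∑ i, d i • evenBasis (CliffordAlgebra.ι Q x) (CliffordAlgebra.ι Q y)
        (CliffordAlgebra.ι Q z) i)
      (∑ i, c i • evenBasis (CliffordAlgebra.ι Q x) (CliffordAlgebra.ι Q y)
        (CliffordAlgebra.ι Q z) i) =
      algebraMap F _ (∑ j, d j * ∑ i, c i * traceMatrix q₀ q₁ q₂ b₀₁ b₀₂ b₁₂ i j) := by
  rw [traceMap_apply]
  simp only [map_sum, map_smul, reverse_evenBasis]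
  rw [Finset.sum_mul_sum, Finset.sum_mul_sum, Finset.sum_comm, ← Finset.sum_add_distrib]
  simp only [Finset.mul_sum, map_sum, smul_mul_smul_comm]
  refine Finset.sum_congr rfl fun j _ => ?_
  rw [← Finset.sum_add_distrib]
  refine Finset.sum_congr rfl fun i _ => ?_
  rw [mul_comm (c i) (d j), ← smul_add, evenBasis_mul_add h, Algebra.algebraMap_eq_smul_one,
    smul_smul, mul_assoc]

theorem linearIndependent_evenBasis [NeZero (2 : F)] {Q : QuadraticForm F W} {x y z : W}
    {q₀ q₁ q₂ b₀₁ b₀₂ b₁₂ : F}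
    (h : TernaryRel_s3 (CliffordAlgebra.ι Q x) (CliffordAlgebra.ι Q y) (CliffordAlgebra.ι Q z)
      q₀ q₁ q₂ b₀₁ b₀₂ b₁₂) (hD : halfDisc q₀ q₁ q₂ b₀₁ b₀₂ b₁₂ ≠ 0) :
    LinearIndependent F (evenBasis (CliffordAlgebra.ι Q x) (CliffordAlgebra.ι Q y)
      (CliffordAlgebra.ι Q z)) := by
  have := invertibleOfNonzero (two_ne_zero (α := F))
  have hinj := (algebraMap F (CliffordAlgebra Q)).injective
  rw [Fintype.linearIndependent_iff]
  intro c hc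
  refine congrFun (Matrix.eq_zero_of_vecMul_eq_zero
    (M := traceMatrix q₀ q₁ q₂ b₀₁ b₀₂ b₁₂) ?_ ?_)
  · rw [det_traceMatrix]
    exact pow_ne_zero 2 hD
  · ext j
    have h1 := traceMap_sum_evenBasis F h c (Pi.single j 1)
    rw [hc, map_zero] at h1
    have h2 := hinj (h1.symm.trans (map_zero _).symm)
    simpa [Pi.single_apply, Matrix.vecMul, dotProduct] using h2

theorem algebraMap_mem_oneLat_iff [NeZero (2 : F)] {Q : QuadraticForm F W} {t : F} :
    algebraMap F (CliffordAlgebra Q) t ∈ oneLat R F W Q ↔ t ∈ (1 : Submodule R F) := by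
  have := invertibleOfNonzero (two_ne_zero (α := F))
  have hinj := (algebraMap F (CliffordAlgebra Q)).injective
  rw [oneLat, LinearMap.mem_range, Submodule.mem_one]
  refine exists_congr fun r => ?_
  rw [Algebra.linearMap_apply, IsScalarTower.algebraMap_apply R F (CliffordAlgebra Q), hinj.eq_iff]

end Clifford

section Main

variable {R F : Type*} [CommRing R] [Field F] [Algebra R F] [NeZero (2 : F)]
variable {W : Type*} [AddCommGroup W] [Module F W] [Module R W] [IsScalarTower R F W]

theorem latIdx_dualLat {ψ : LinearMap.BilinForm F W} (hsymm : ψ.IsSymm) (N : Submodule R W)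
    (b : Module.Basis (Fin 3) F W) (𝔞 : Fin 3 → (Submodule R F)ˣ)
    (hb : ∀ x, x ∈ N ↔ ∀ i, b.repr x i ∈ (𝔞 i : Submodule R F))
    (hD : halfDisc (ψ (b 0) (b 0)) (ψ (b 1) (b 1)) (ψ (b 2) (b 2)) (2 * ψ (b 0) (b 1))
      (2 * ψ (b 0) (b 2)) (2 * ψ (b 1) (b 2)) ≠ 0) :
    latIdx R F W (dualLat R F W ψ N) N =
      Submodule.span R {2 * halfDisc (ψ (b 0) (b 0)) (ψ (b 1) (b 1)) (ψ (b 2) (b 2))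
        (2 * ψ (b 0) (b 1)) (2 * ψ (b 0) (b 2)) (2 * ψ (b 1) (b 2))} *
        ∏ i, ((𝔞 i : Submodule R F) * (𝔞 i : Submodule R F)) := by
  let f : Fin 3 → W →ₗ[F] F := fun i => (2 : F) • ψ.flip (b i)
  have hf : ∀ i x, f i x = 2 * ψ x (b i) := fun i x => rfl
  have hdet : (Matrix.of fun i j => f i (b j)).det =
      2 * halfDisc (ψ (b 0) (b 0)) (ψ (b 1) (b 1)) (ψ (b 2) (b 2)) (2 * ψ (b 0) (b 1))
        (2 * ψ (b 0) (b 2)) (2 * ψ (b 1) (b 2)) := by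
    rw [Matrix.det_fin_three]
    simp only [Matrix.of_apply, hf, hsymm.eq (b 1) (b 0), hsymm.eq (b 2) (b 0),
      hsymm.eq (b 2) (b 1), halfDisc]
    ring
  rw [← hdet]
  refine latIdx_eq_span_det_mul_prod b f 𝔞 N _ hb (fun x => ?_) (hdet ▸ mul_ne_zero two_ne_zero hD)
  rw [← forall_pairing_mem_one_iff b 𝔞 N hb fun i => f i x]
  simp only [dualLat, Submodule.mem_iInf, Submodule.mem_comap]
  refine forall₂_congr fun y _ => ?_
  have h1 : ((2 : F) • ψ.flip y) x = ∑ i, b.repr y i * f i x := by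
    simp only [hf]
    conv_lhs => rw [← b.sum_repr y]
    simp only [LinearMap.smul_apply, map_sum, LinearMap.sum_apply, map_smul, smul_eq_mul,
      LinearMap.BilinForm.flip_apply, Finset.mul_sum]
    exact Finset.sum_congr rfl fun i _ => by ring
  rw [← h1, Submodule.one_eq_range]
  rfl

theorem APlusDualIdx_eq {ψ : LinearMap.BilinForm F W} (hsymm : ψ.IsSymm) (N : Submodule R W)
    (b : Module.Basis (Fin 3) F W) (𝔞 : Fin 3 → (Submodule R F)ˣ)
    (hb : ∀ x, x ∈ N ↔ ∀ i, b.repr x i ∈ (𝔞 i : Submodule R F))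
    (hI : IntegralGram (𝔞 0 : Submodule R F) (𝔞 1 : Submodule R F) (𝔞 2 : Submodule R F)
      (ψ (b 0) (b 0)) (ψ (b 1) (b 1)) (ψ (b 2) (b 2)) (2 * ψ (b 0) (b 1))
      (2 * ψ (b 0) (b 2)) (2 * ψ (b 1) (b 2)))
    (hD : halfDisc (ψ (b 0) (b 0)) (ψ (b 1) (b 1)) (ψ (b 2) (b 2)) (2 * ψ (b 0) (b 1))
      (2 * ψ (b 0) (b 2)) (2 * ψ (b 1) (b 2)) ≠ 0) :
    APlusDualIdx R F W ψ N =
      Submodule.span R {halfDisc (ψ (b 0) (b 0)) (ψ (b 1) (b 1)) (ψ (b 2) (b 2))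
        (2 * ψ (b 0) (b 1)) (2 * ψ (b 0) (b 2)) (2 * ψ (b 1) (b 2)) ^ 2} *
        (∏ i, ((𝔞 i : Submodule R F) * (𝔞 i : Submodule R F))) ^ 2 := by
  have hrel := ternaryRel_ι_s3 hsymm (b 0) (b 1) (b 2)
  set Q := LinearMap.BilinMap.toQuadraticMap ψ with hQ
  generalize ψ (b 0) (b 0) = q₀, ψ (b 1) (b 1) = q₁, ψ (b 2) (b 2) = q₂,
    2 * ψ (b 0) (b 1) = b₀₁, 2 * ψ (b 0) (b 2) = b₀₂, 2 * ψ (b 1) (b 2) = b₁₂ at *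
  let U := Subalgebra.toSubmodule (CliffordAlgebra.even Q)
  let v := evenBasis (CliffordAlgebra.ι Q (b 0)) (CliffordAlgebra.ι Q (b 1))
    (CliffordAlgebra.ι Q (b 2))
  let vU : Fin 4 → U := fun i => ⟨v i, evenBasis_mem_even Q _ _ _ i⟩
  have hli : LinearIndependent F vU :=
    LinearIndependent.of_comp U.subtype (linearIndependent_evenBasis hrel hD)
  have hspan : ⊤ ≤ Submodule.span F (Set.range vU) := by
    rintro ⟨u, hu⟩ -
    obtain ⟨c, hc⟩ := exists_evenBasis_combination b hrel hu
    rw [Submodule.mem_span_range_iff_exists_fun]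
    refine ⟨c, Subtype.ext ?_⟩
    change U.subtype (∑ i, c i • vU i) = u
    rw [map_sum, ← hc]
    rfl
  let B : Module.Basis (Fin 4) F U := Module.Basis.mk hli hspan
  have hBv : ∀ i, B i = vU i := fun i => Module.Basis.mk_apply hli hspan i
  have hBsum : ∀ u : U, ∑ i, B.repr u i • v i = u := fun u => by
    have h1 := congrArg U.subtype (B.sum_repr u)
    rw [map_sum] at h1
    simp only [map_smul, hBv] at h1
    exact h1
  let 𝔠 : Fin 4 → (Submodule R F)ˣ := ![1, 𝔞 0 * 𝔞 1, 𝔞 0 * 𝔞 2, 𝔞 1 * 𝔞 2]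
  have h𝔠 : ∀ i, (𝔠 i : Submodule R F) = evenCoeff (𝔞 0 : Submodule R F) (𝔞 1) (𝔞 2) i := by
    intro i
    fin_cases i <;> rfl
  let L : Submodule R U := (APlusSub R F W Q N).comap (U.subtype.restrictScalars R)
  let L' : Submodule R U :=
    (normDual R F W Q (APlusSub R F W Q N)).comap (U.subtype.restrictScalars R)
  have hA := mem_APlusSub_iff N b (fun i => (𝔞 i : Submodule R F)) hb hrel hI
  have hL : ∀ x, x ∈ L ↔ ∀ i, B.repr x i ∈ (𝔠 i : Submodule R F) := by
    intro x
    simp only [h𝔠]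
    change (x : CliffordAlgebra Q) ∈ APlusSub R F W Q N ↔ _
    rw [hA, mem_coeffSpan]
    constructor
    · rintro ⟨c, hc, hcx⟩ i
      have h1 : x = ∑ i, c i • B i := Subtype.ext (by
        change _ = U.subtype (∑ i, c i • B i)
        rw [map_sum]
        simp only [map_smul, hBv]
        exact hcx.symm)
      rw [h1, B.repr_sum_self]
      exact hc i
    · exact fun h => ⟨fun i => B.repr x i, h, hBsum x⟩
  let T := traceMatrix q₀ q₁ q₂ b₀₁ b₀₂ b₁₂
  let f : Fin 4 → U →ₗ[F] F := fun j => ∑ i, T i j • B.coord i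
  have hf : ∀ j x, f j x = ∑ i, B.repr x i * T i j := fun j x => by
    simp [f, mul_comm]
  have hfB : (Matrix.of fun i j => f i (B j)) = T.transpose := by
    ext i j
    simp [hf, Finsupp.single_apply]
  have hdet : (Matrix.of fun i j => f i (B j)).det = halfDisc q₀ q₁ q₂ b₀₁ b₀₂ b₁₂ ^ 2 := by
    rw [hfB, Matrix.det_transpose, det_traceMatrix]
  have hT : ∀ x y : U, traceMap R F W Q (y : CliffordAlgebra Q) (x : CliffordAlgebra Q) =
      algebraMap F _ (∑ j, B.repr y j * f j x) := fun x y => by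
    have h1 := traceMap_sum_evenBasis R hrel (fun i => B.repr x i) fun i => B.repr y i
    simp only [hf]
    rw [← h1]
    exact congrArg₂ (fun s t => traceMap R F W Q s t) (hBsum y).symm (hBsum x).symm
  have hL' : ∀ x, x ∈ L' ↔ ∀ i, f i x ∈ (((𝔠 i)⁻¹ : (Submodule R F)ˣ) : Submodule R F) := by
    intro x
    rw [← forall_pairing_mem_one_iff B 𝔠 L hL fun i => f i x]
    change (x : CliffordAlgebra Q) ∈ normDual R F W Q (APlusSub R F W Q N) ↔ _
    simp only [normDual, Submodule.mem_inf, Submodule.mem_iInf, Submodule.mem_comap]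
    constructor
    · rintro ⟨-, h⟩ y hy
      rw [← algebraMap_mem_oneLat_iff (Q := Q), ← hT]
      exact h _ hy
    · refine fun h => ⟨x.2, fun y hy => ?_⟩
      have h1 := h ⟨y, hy.1⟩ hy
      rwa [← algebraMap_mem_oneLat_iff (Q := Q), ← hT] at h1
  have key := latIdx_eq_span_det_mul_prod B f 𝔠 L L' hL hL' (hdet ▸ pow_ne_zero 2 hD)
  rw [hdet] at key
  refine Eq.trans key ?_
  congr 1
  rw [Fin.prod_univ_four, Fin.prod_univ_three]
  simp only [𝔠, Matrix.cons_val, Units.val_one, Units.val_mul]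
  ring

theorem halfDisc_ne_zero {ψ : LinearMap.BilinForm F W} (hsymm : ψ.IsSymm)
    (hnd : LinearMap.BilinForm.Nondegenerate ψ) (b : Module.Basis (Fin 3) F W) :
    halfDisc (ψ (b 0) (b 0)) (ψ (b 1) (b 1)) (ψ (b 2) (b 2)) (2 * ψ (b 0) (b 1))
      (2 * ψ (b 0) (b 2)) (2 * ψ (b 1) (b 2)) ≠ 0 := by
  have h1 : (LinearMap.BilinForm.toMatrix b ψ).det ≠ 0 :=
    (LinearMap.BilinForm.nondegenerate_iff_det_ne_zero b).1 hnd
  have h2 : halfDisc (ψ (b 0) (b 0)) (ψ (b 1) (b 1)) (ψ (b 2) (b 2)) (2 * ψ (b 0) (b 1))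
      (2 * ψ (b 0) (b 2)) (2 * ψ (b 1) (b 2)) = 2 ^ 2 * (LinearMap.BilinForm.toMatrix b ψ).det := by
    rw [Matrix.det_fin_three]
    simp only [LinearMap.BilinForm.toMatrix_apply, hsymm.eq (b 1) (b 0), hsymm.eq (b 2) (b 0),
      hsymm.eq (b 2) (b 1), halfDisc]
    ring
  rw [h2]
  exact mul_ne_zero (pow_ne_zero 2 two_ne_zero) h1

/-- The discriminant formula over an arbitrary Dedekind domain whose fraction field has
characteristic different from two. -/
theorem halfDualIdx_le_one_and_APlusDualIdx_eq [IsDedekindDomain R] [IsFractionRing R F]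
    (hW : Module.finrank F W = 3)
    (ψ : LinearMap.BilinForm F W) (hsymm : ψ.IsSymm)
    (hnd : LinearMap.BilinForm.Nondegenerate ψ) (N : Submodule R W)
    (hN : IsIntegralLat R F W ψ N) :
    halfDualIdx R F W ψ N ≤ 1 ∧
      APlusDualIdx R F W ψ N = halfDualIdx R F W ψ N * halfDualIdx R F W ψ N := by
  have : FiniteDimensional F W := Module.finite_of_finrank_eq_succ hW
  obtain ⟨b, 𝔞, hb⟩ := exists_basis_mem_iff 3 W hW N hN.1
  have hD := halfDisc_ne_zero hsymm hnd b
  have hI := integralGram_of_isIntegralLat hsymm hN b (fun i => (𝔞 i : Submodule R F))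
    fun i c hc => by
      rw [hb]
      intro j
      rw [map_smul, b.repr_self, Finsupp.smul_single, smul_eq_mul, mul_one, Finsupp.single_apply]
      split_ifs with hij
      · exact hij ▸ hc
      · exact zero_mem _
  have hhalf : halfDualIdx R F W ψ N =
      Submodule.span R {halfDisc (ψ (b 0) (b 0)) (ψ (b 1) (b 1)) (ψ (b 2) (b 2))
        (2 * ψ (b 0) (b 1)) (2 * ψ (b 0) (b 2)) (2 * ψ (b 1) (b 2))} *
        ∏ i, ((𝔞 i : Submodule R F) * (𝔞 i : Submodule R F)) := by
    rw [halfDualIdx, latIdx_dualLat hsymm N b 𝔞 hb hD, ← mul_assoc, Submodule.span_mul_span,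
      Set.singleton_mul_singleton, inv_mul_cancel_left₀ two_ne_zero]
  refine ⟨hhalf ▸ span_halfDisc_mul_prod_le_one (I := fun i => (𝔞 i : Submodule R F)) hI, ?_⟩
  rw [hhalf, APlusDualIdx_eq hsymm N b 𝔞 hb hI hD, mul_mul_mul_comm, Submodule.span_mul_span,
    Set.singleton_mul_singleton, ← sq, ← sq]

end Main

end Paper

open Paper NumberField

/-- For an integral lattice `N` in a nondegenerate ternary quadratic
space over a number field, the discriminant of the order `A⁺(N)` in the quaternion
algebra `A⁺(W)` equals `2⁻¹[Ñ/N]`; that is, `2⁻¹[Ñ/N]` is an integral ideal whose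
square is `[A⁺(N)~/A⁺(N)]`. -/
theorem statement3
    (F : Type*) [Field F] [NumberField F]
    (W : Type*) [AddCommGroup W] [Module F W]
    [Module (RingOfIntegers F) W] [IsScalarTower (RingOfIntegers F) F W]
    (hW : Module.finrank F W = 3)
    (ψ : LinearMap.BilinForm F W) (hsymm : ψ.IsSymm)
    (hnd : LinearMap.BilinForm.Nondegenerate ψ)
    (N : Submodule (RingOfIntegers F) W)
    (hN : IsIntegralLat (RingOfIntegers F) F W ψ N) :
    halfDualIdx (RingOfIntegers F) F W ψ N ≤ 1 ∧
    APlusDualIdx (RingOfIntegers F) F W ψ N =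
      halfDualIdx (RingOfIntegers F) F W ψ N * halfDualIdx (RingOfIntegers F) F W ψ N := by
  exact halfDualIdx_le_one_and_APlusDualIdx_eq hW ψ hsymm hnd N hN
end
end
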